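/- arXiv:1111.0666 — 3 statements merged into one kernel-verified Lean document; each statement's English description precedes it below -/
import Mathlib

section
/- Let u be a vanishing viscosity solution on Ω of the intrinsic minimal surface equation. Fix a point (x₁,x₂) ∈ Ω and let γ be the integral curve of the Lipschitz vector field x ↦ (σ₁¹(x,u(x)), σ₁²(x,u(x))) with γ(0) = (x₁,x₂). Then the function t ↦ u(γ(t)) is twice differentiable on the interval of existence of γ and satisfies (d²/dt²) u(γ(t)) = 0 identically; in other words, u is affine along every integral curve of X_{1,u}, and these horizontal curves foliate Ω. -/
open MeasureTheory Real Filter Topology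

noncomputable section

/-- Partial derivative ∂ₓ₁ on ℝ². -/
def pd1 (f : ℝ × ℝ → ℝ) (p : ℝ × ℝ) : ℝ := fderiv ℝ f p (1, 0)

/-- Partial derivative ∂ₓ₂ on ℝ². -/
def pd2 (f : ℝ × ℝ → ℝ) (p : ℝ × ℝ) : ℝ := fderiv ℝ f p (0, 1)

/-- Partial derivative ∂ₓ₃ on ℝ³ = ℝ × ℝ × ℝ. -/
def pd3 (g : ℝ × ℝ × ℝ → ℝ) (q : ℝ × ℝ × ℝ) : ℝ := fderiv ℝ g q (0, 0, 1)

/-- Vector field a·∂ₓ₁ + b·∂ₓ₂ with coefficients evaluated along the graph of u. -/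
def VF (a b : ℝ × ℝ × ℝ → ℝ) (u : ℝ × ℝ → ℝ) (f : ℝ × ℝ → ℝ) (p : ℝ × ℝ) : ℝ :=
  a (p.1, p.2, u p) * pd1 f p + b (p.1, p.2, u p) * pd2 f p

/-- The nonlinear vector field X₁ = X_{1,u}. -/
def X1 (s11 s12 : ℝ × ℝ × ℝ → ℝ) (u : ℝ × ℝ → ℝ) : (ℝ × ℝ → ℝ) → ℝ × ℝ → ℝ :=
  VF s11 s12 u

/-- The transverse vector field Y = X₂/ε (coefficients σ₂ʲ = ∂ₓ₃σ₁ʲ). -/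
def Yf (s11 s12 : ℝ × ℝ × ℝ → ℝ) (u : ℝ × ℝ → ℝ) : (ℝ × ℝ → ℝ) → ℝ × ℝ → ℝ :=
  VF (pd3 s11) (pd3 s12) u

/-- The scaled vector field X₂ = ε·Y. -/
def X2 (s11 s12 : ℝ × ℝ × ℝ → ℝ) (ε : ℝ) (u : ℝ × ℝ → ℝ) (f : ℝ × ℝ → ℝ) (p : ℝ × ℝ) : ℝ :=
  ε * Yf s11 s12 u f p

/-- The pair (X₁, X₂) of vector fields. -/
def XX (s11 s12 : ℝ × ℝ × ℝ → ℝ) (ε : ℝ) (u : ℝ × ℝ → ℝ) :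
    Fin 2 → (ℝ × ℝ → ℝ) → ℝ × ℝ → ℝ :=
  ![X1 s11 s12 u, X2 s11 s12 ε u]

/-- |∇ε f| = |(X₁f, X₂f)|. -/
def gradN (s11 s12 : ℝ × ℝ × ℝ → ℝ) (ε : ℝ) (u f : ℝ × ℝ → ℝ) (p : ℝ × ℝ) : ℝ :=
  Real.sqrt ((X1 s11 s12 u f p) ^ 2 + (X2 s11 s12 ε u f p) ^ 2)

/-- The weight √(1+|∇εu|²). -/
def Wt (s11 s12 : ℝ × ℝ × ℝ → ℝ) (ε : ℝ) (u : ℝ × ℝ → ℝ) (p : ℝ × ℝ) : ℝ :=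
  Real.sqrt (1 + (gradN s11 s12 ε u u p) ^ 2)

/-- The regularized minimal surface operator L_{ε,u}u = Σᵢ Xᵢ(Xᵢu/√(1+|∇εu|²)). -/
def Lop (s11 s12 : ℝ × ℝ × ℝ → ℝ) (ε : ℝ) (u : ℝ × ℝ → ℝ) (p : ℝ × ℝ) : ℝ :=
  X1 s11 s12 u (fun q => X1 s11 s12 u u q / Wt s11 s12 ε u q) p +
  X2 s11 s12 ε u (fun q => X2 s11 s12 ε u u q / Wt s11 s12 ε u q) p

/-- The coefficients a_{ij}(∇εu) = δ_{ij} − (Xᵢu)(Xⱼu)/(1+|∇εu|²). -/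
def aC (s11 s12 : ℝ × ℝ × ℝ → ℝ) (ε : ℝ) (u : ℝ × ℝ → ℝ) (i j : Fin 2) (p : ℝ × ℝ) : ℝ :=
  (if i = j then 1 else 0) -
    XX s11 s12 ε u i u p * XX s11 s12 ε u j u p / (1 + (gradN s11 s12 ε u u p) ^ 2)

/-- The coefficients 𝒜_{ij} = a_{ij}(∇εu)/√(1+|∇εu|²). -/
def AC (s11 s12 : ℝ × ℝ × ℝ → ℝ) (ε : ℝ) (u : ℝ × ℝ → ℝ) (i j : Fin 2) (p : ℝ × ℝ) : ℝ :=
  aC s11 s12 ε u i j p / Wt s11 s12 ε u p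

/-- The linearized divergence–form operator M_{ε,u}z = Σ_{i,j} Xᵢ(𝒜_{ij}·Xⱼz). -/
def Mop (s11 s12 : ℝ × ℝ × ℝ → ℝ) (ε : ℝ) (u z : ℝ × ℝ → ℝ) (p : ℝ × ℝ) : ℝ :=
  ∑ i : Fin 2, ∑ j : Fin 2,
    XX s11 s12 ε u i (fun q => AC s11 s12 ε u i j q * XX s11 s12 ε u j z q) p

/-- Iterated derivatives X_{i₁}⋯X_{i_k} z. -/
def iterX (s11 s12 : ℝ × ℝ × ℝ → ℝ) (ε : ℝ) (u : ℝ × ℝ → ℝ) :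
    (k : ℕ) → (Fin k → Fin 2) → (ℝ × ℝ → ℝ) → ℝ × ℝ → ℝ
  | 0, _, z => z
  | k + 1, I, z => XX s11 s12 ε u (I 0) (iterX s11 s12 ε u k (fun j => I j.succ) z)

/-- |∇εᵏ z| : Euclidean norm of the vector of all k-fold iterated derivatives. -/
def gradkN (s11 s12 : ℝ × ℝ × ℝ → ℝ) (ε : ℝ) (u : ℝ × ℝ → ℝ) (k : ℕ) (z : ℝ × ℝ → ℝ)
    (p : ℝ × ℝ) : ℝ :=
  Real.sqrt (∑ I : Fin k → Fin 2, (iterX s11 s12 ε u k I z p) ^ 2)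

/-- Lᵖ norm over K. -/
def LpN (q : ℝ) (f : ℝ × ℝ → ℝ) (K : Set (ℝ × ℝ)) : ℝ :=
  (∫ p in K, |f p| ^ q) ^ (1 / q)

/-- Sobolev norm ‖z‖_{Wε^{m,q}(K)} = Σ_{k=0}^m ‖|∇εᵏz|‖_{Lᵠ(K)}. -/
def WN (s11 s12 : ℝ × ℝ × ℝ → ℝ) (ε : ℝ) (u : ℝ × ℝ → ℝ) (m : ℕ) (q : ℝ)
    (z : ℝ × ℝ → ℝ) (K : Set (ℝ × ℝ)) : ℝ :=
  ∑ k ∈ Finset.range (m + 1), LpN q (gradkN s11 s12 ε u k z) K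

/-- m₁ = ∂ₓ₁[σ₁¹(·,u)] + ∂ₓ₂[σ₁²(·,u)]. -/
def m1 (s11 s12 : ℝ × ℝ × ℝ → ℝ) (u : ℝ × ℝ → ℝ) (p : ℝ × ℝ) : ℝ :=
  pd1 (fun q => s11 (q.1, q.2, u q)) p + pd2 (fun q => s12 (q.1, q.2, u q)) p

/-- Euclidean gradient length |∇_E f|. -/
def egN (f : ℝ × ℝ → ℝ) (p : ℝ × ℝ) : ℝ :=
  Real.sqrt ((pd1 f p) ^ 2 + (pd2 f p) ^ 2)

/-- A cutoff function in Ω: smooth, compactly supported in Ω, 0 ≤ φ ≤ 1. -/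
def IsCutoff (Ω : Set (ℝ × ℝ)) (φ : ℝ × ℝ → ℝ) : Prop :=
  ContDiff ℝ (⊤ : ℕ∞) φ ∧ HasCompactSupport φ ∧ tsupport φ ⊆ Ω ∧ ∀ p, 0 ≤ φ p ∧ φ p ≤ 1

/-- A test function φ ∈ C∞_c(Ω). -/
def IsTest (Ω : Set (ℝ × ℝ)) (φ : ℝ × ℝ → ℝ) : Prop :=
  ContDiff ℝ (⊤ : ℕ∞) φ ∧ HasCompactSupport φ ∧ tsupport φ ⊆ Ω

/-- The Lipschitz bound ‖X₁u‖_{L∞(Ω)} + ‖Yu‖_{L∞(Ω)} ≤ M. -/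
def LipBound (s11 s12 : ℝ × ℝ × ℝ → ℝ) (Ω : Set (ℝ × ℝ)) (u : ℝ × ℝ → ℝ) (M : ℝ) : Prop :=
  ∀ p ∈ Ω, |X1 s11 s12 u u p| + |Yf s11 s12 u u p| ≤ M

/-- Rank condition |σ₁¹·∂ₓ₃σ₁² − σ₁²·∂ₓ₃σ₁¹| > 0. -/
def RankCond (s11 s12 : ℝ × ℝ × ℝ → ℝ) : Prop :=
  ∀ q : ℝ × ℝ × ℝ, 0 < |s11 q * pd3 s12 q - s12 q * pd3 s11 q|

/-- Vanishing viscosity solution of the intrinsic minimal surface equation. -/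
def IsVVSol (s11 s12 : ℝ × ℝ × ℝ → ℝ) (Ω : Set (ℝ × ℝ)) (u : ℝ × ℝ → ℝ) : Prop :=
  ∃ (εs : ℕ → ℝ) (us : ℕ → ℝ × ℝ → ℝ) (l : NNReal),
    (∀ n, 0 < εs n ∧ εs n ≤ 1) ∧ Tendsto εs atTop (𝓝 0) ∧
    (∀ n, ContDiff ℝ (⊤ : ℕ∞) (us n)) ∧
    (∀ n, ∀ p ∈ Ω, Lop s11 s12 (εs n) (us n) p = 0) ∧
    (∀ n, LipschitzOnWith l (us n) Ω) ∧ (∀ n, ∀ p ∈ Ω, |us n p| ≤ l) ∧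
    (∀ K ⊆ Ω, IsCompact K → TendstoUniformlyOn us u atTop K)

/-- The antisymmetric commutator coefficients ω^l_{j,k} with ω^l_{1,2} = ω^l. -/
def wAnti (ω : Fin 2 → ℝ × ℝ → ℝ) (l j k : Fin 2) (p : ℝ × ℝ) : ℝ :=
  if j = k then 0 else if j = 0 then ω l p else -(ω l p)

/-- Euclidean Hölder class C^{1,α} on Ω. -/
def EuclC1Alpha (Ω : Set (ℝ × ℝ)) (α : ℝ) (h : ℝ × ℝ → ℝ) : Prop :=
  Differentiable ℝ h ∧
    ∃ H : ℝ, ∀ p ∈ Ω, ∀ q ∈ Ω, ‖fderiv ℝ h p - fderiv ℝ h q‖ ≤ H * dist p q ^ α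

/-- Frozen first-order intrinsic Taylor polynomial P_{x₀}h. -/
def Pfroz (s11 s12 : ℝ × ℝ × ℝ → ℝ) (ε : ℝ) (u h : ℝ × ℝ → ℝ) (x0 x : ℝ × ℝ) : ℝ :=
  h x0 +
    ((pd3 s12 (x0.1, x0.2, u x0) /
        (s11 (x0.1, x0.2, u x0) * pd3 s12 (x0.1, x0.2, u x0) -
          s12 (x0.1, x0.2, u x0) * pd3 s11 (x0.1, x0.2, u x0))) * (x - x0).1 -
      (pd3 s11 (x0.1, x0.2, u x0) /
        (s11 (x0.1, x0.2, u x0) * pd3 s12 (x0.1, x0.2, u x0) -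
          s12 (x0.1, x0.2, u x0) * pd3 s11 (x0.1, x0.2, u x0))) * (x - x0).2) *
      X1 s11 s12 u h x0 +
    ((1 / ε) *
      ((s11 (x0.1, x0.2, u x0) /
          (s11 (x0.1, x0.2, u x0) * pd3 s12 (x0.1, x0.2, u x0) -
            s12 (x0.1, x0.2, u x0) * pd3 s11 (x0.1, x0.2, u x0))) * (x - x0).2 -
        (s12 (x0.1, x0.2, u x0) /
          (s11 (x0.1, x0.2, u x0) * pd3 s12 (x0.1, x0.2, u x0) -
            s12 (x0.1, x0.2, u x0) * pd3 s11 (x0.1, x0.2, u x0))) * (x - x0).1)) *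
      X2 s11 s12 ε u h x0

/-- Graph coefficient field of the horizontal vector field. -/
def GF (s11 s12 : ℝ × ℝ × ℝ → ℝ) (r : (ℝ × ℝ) × ℝ) : ℝ × ℝ :=
  (s11 (r.1.1, r.1.2, r.2), s12 (r.1.1, r.1.2, r.2))

/-- Its vertical derivative. -/
def TF (G : (ℝ × ℝ) × ℝ → ℝ × ℝ) (r : (ℝ × ℝ) × ℝ) : ℝ × ℝ := fderiv ℝ G r (0, 1)

lemma VF_eq (a b : ℝ × ℝ × ℝ → ℝ) (u f : ℝ × ℝ → ℝ) (p : ℝ × ℝ) :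
    VF a b u f p = fderiv ℝ f p (a (p.1, p.2, u p), b (p.1, p.2, u p)) := by
  have : (a (p.1, p.2, u p), b (p.1, p.2, u p)) =
      a (p.1, p.2, u p) • ((1 : ℝ), (0 : ℝ)) + b (p.1, p.2, u p) • ((0 : ℝ), (1 : ℝ)) := by
    simp
  rw [this, map_add, map_smul, map_smul]
  simp [VF, pd1, pd2]

lemma contDiff_GF {s11 s12 : ℝ × ℝ × ℝ → ℝ} (h1 : ContDiff ℝ (⊤ : ℕ∞) s11)
    (h2 : ContDiff ℝ (⊤ : ℕ∞) s12) : ContDiff ℝ (⊤ : ℕ∞) (GF s11 s12) := by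
  unfold GF
  fun_prop

lemma contDiff_TF {G : (ℝ × ℝ) × ℝ → ℝ × ℝ} (h : ContDiff ℝ (⊤ : ℕ∞) G) :
    ContDiff ℝ (⊤ : ℕ∞) (TF G) := by
  unfold TF
  have : ContDiff ℝ (⊤ : ℕ∞) (fderiv ℝ G) := h.fderiv_right (by simp)
  fun_prop

lemma TF_GF {s11 s12 : ℝ × ℝ × ℝ → ℝ} (h1 : ContDiff ℝ (⊤ : ℕ∞) s11)
    (h2 : ContDiff ℝ (⊤ : ℕ∞) s12) (r : (ℝ × ℝ) × ℝ) :
    TF (GF s11 s12) r = (pd3 s11 (r.1.1, r.1.2, r.2), pd3 s12 (r.1.1, r.1.2, r.2)) := by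
  have d1 : Differentiable ℝ s11 := h1.differentiable (by simp)
  have d2 : Differentiable ℝ s12 := h2.differentiable (by simp)
  have hA : HasFDerivAt (fun r : (ℝ × ℝ) × ℝ => (r.1.1, r.1.2, r.2))
      (((ContinuousLinearMap.fst ℝ ℝ ℝ).comp (ContinuousLinearMap.fst ℝ (ℝ × ℝ) ℝ)).prod
        (((ContinuousLinearMap.snd ℝ ℝ ℝ).comp (ContinuousLinearMap.fst ℝ (ℝ × ℝ) ℝ)).prod
          (ContinuousLinearMap.snd ℝ (ℝ × ℝ) ℝ))) r :=
    (((ContinuousLinearMap.fst ℝ ℝ ℝ).comp (ContinuousLinearMap.fst ℝ (ℝ × ℝ) ℝ)).prod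
        (((ContinuousLinearMap.snd ℝ ℝ ℝ).comp (ContinuousLinearMap.fst ℝ (ℝ × ℝ) ℝ)).prod
          (ContinuousLinearMap.snd ℝ (ℝ × ℝ) ℝ))).hasFDerivAt
  have e1 := (d1 (r.1.1, r.1.2, r.2)).hasFDerivAt.comp r hA
  have e2 := (d2 (r.1.1, r.1.2, r.2)).hasFDerivAt.comp r hA
  have e := (e1.prodMk e2).fderiv
  have e' : TF (GF s11 s12) r = fderiv ℝ (fun x : (ℝ × ℝ) × ℝ =>
    ((s11 ∘ fun r : (ℝ × ℝ) × ℝ => (r.1.1, r.1.2, r.2)) x,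
     (s12 ∘ fun r : (ℝ × ℝ) × ℝ => (r.1.1, r.1.2, r.2)) x)) r (0, 1) := rfl
  rw [e', e]
  simp [pd3]

/-- Derivative of a directional derivative. -/
lemma fderiv_dir {u : ℝ × ℝ → ℝ} (hu : ContDiff ℝ (⊤ : ℕ∞) u) {H : (ℝ × ℝ) × ℝ → ℝ × ℝ}
    (hH : ContDiff ℝ (⊤ : ℕ∞) H) (p : ℝ × ℝ) :
    DifferentiableAt ℝ (fun q => fderiv ℝ u q (H (q, u q))) p ∧ ∀ ξ,
    fderiv ℝ (fun q => fderiv ℝ u q (H (q, u q))) p ξ =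
      fderiv ℝ (fderiv ℝ u) p ξ (H (p, u p)) +
        fderiv ℝ u p (fderiv ℝ H (p, u p) (ξ, fderiv ℝ u p ξ)) := by
  have hdu : ContDiff ℝ (⊤ : ℕ∞) (fderiv ℝ u) := hu.fderiv_right (by simp)
  have d1 : DifferentiableAt ℝ (fderiv ℝ u) p := (hdu.differentiable (by simp)) p
  have d2 : DifferentiableAt ℝ u p := (hu.differentiable (by simp)) p
  have d3 : DifferentiableAt ℝ H (p, u p) := (hH.differentiable (by simp)) _
  have e1 : HasFDerivAt (fun q => (q, u q)) ((ContinuousLinearMap.id ℝ (ℝ × ℝ)).prod (fderiv ℝ u p)) p :=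
    (hasFDerivAt_id p).prodMk d2.hasFDerivAt
  have e2 := d3.hasFDerivAt.comp p e1
  have e3 := d1.hasFDerivAt.clm_apply e2
  refine ⟨e3.differentiableAt, fun ξ => ?_⟩
  have := e3.fderiv
  change fderiv ℝ (fun q => fderiv ℝ u q ((H ∘ fun q => (q, u q)) q)) p ξ = _
  rw [this]
  simp [add_comm]

lemma quot_fderiv {f g h : ℝ × ℝ → ℝ} {p : ℝ × ℝ} (hf : DifferentiableAt ℝ f p)
    (hg : DifferentiableAt ℝ g p) (hh : DifferentiableAt ℝ h p) (ξ : ℝ × ℝ) :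
    (Real.sqrt (1 + f p ^ 2 + g p ^ 2)) ^ 3 *
      fderiv ℝ (fun q => h q / Real.sqrt (1 + f q ^ 2 + g q ^ 2)) p ξ =
      (1 + f p ^ 2 + g p ^ 2) * fderiv ℝ h p ξ -
        h p * (f p * fderiv ℝ f p ξ + g p * fderiv ℝ g p ξ) := by
  have pos : 0 < 1 + f p ^ 2 + g p ^ 2 := by positivity
  have e1 : HasFDerivAt (fun q => 1 + f q ^ 2 + g q ^ 2) _ p :=
    ((hf.hasFDerivAt.pow 2).const_add 1).add (hg.hasFDerivAt.pow 2)
  have e2 := e1.sqrt pos.ne'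
  have sp : 0 < Real.sqrt (1 + f p ^ 2 + g p ^ 2) := Real.sqrt_pos.2 pos
  have dk : DifferentiableAt ℝ (fun q => h q / Real.sqrt (1 + f q ^ 2 + g q ^ 2)) p := by
    simp only [div_eq_mul_inv]
    exact hh.fun_mul (e2.differentiableAt.fun_inv sp.ne')
  have e3 := (dk.hasFDerivAt.mul e2).fderiv
  have e4 : ((fun q => h q / Real.sqrt (1 + f q ^ 2 + g q ^ 2)) *
      (fun q => Real.sqrt (1 + f q ^ 2 + g q ^ 2))) = h := by
    funext q
    have : 0 < Real.sqrt (1 + f q ^ 2 + g q ^ 2) := Real.sqrt_pos.2 (by positivity)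
    simp only [Pi.mul_apply]
    field_simp
  rw [e4] at e3
  have e5 := congrArg (fun A : (ℝ × ℝ) →L[ℝ] ℝ => A ξ) e3
  have s2 := Real.sq_sqrt pos.le
  set S := Real.sqrt (1 + f p ^ 2 + g p ^ 2)
  set k := fderiv ℝ (fun q => h q / Real.sqrt (1 + f q ^ 2 + g q ^ 2)) p ξ with hk
  simp [← hk] at e5
  rw [e5, ← s2]
  field_simp
  ring

lemma pde_point {s11 s12 : ℝ × ℝ × ℝ → ℝ} (h1 : ContDiff ℝ (⊤ : ℕ∞) s11)
    (h2 : ContDiff ℝ (⊤ : ℕ∞) s12) {u : ℝ × ℝ → ℝ} (hu : ContDiff ℝ (⊤ : ℕ∞) u) (ε : ℝ)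
    (p : ℝ × ℝ) (hL : Lop s11 s12 ε u p = 0)
    (D : ℝ × ℝ → ℝ) (hD : ∀ ξ, D ξ = fderiv ℝ u p ξ)
    (Q : ℝ × ℝ → ℝ × ℝ → ℝ) (hQ : ∀ ξ η, Q ξ η = fderiv ℝ (fderiv ℝ u) p ξ η)
    (v1 v2 : ℝ × ℝ) (hv1 : v1 = GF s11 s12 (p, u p)) (hv2 : v2 = TF (GF s11 s12) (p, u p))
    (W1 W2 : ℝ × ℝ → ℝ × ℝ)
    (hW1 : ∀ ξ, W1 ξ = fderiv ℝ (GF s11 s12) (p, u p) (ξ, D ξ))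
    (hW2 : ∀ ξ, W2 ξ = fderiv ℝ (TF (GF s11 s12)) (p, u p) (ξ, D ξ)) :
    (1 + (ε * D v2) ^ 2) * (Q v1 v1 + D (W1 v1))
      - D v1 * (ε * D v2) * (ε * (Q v1 v2 + D (W2 v1)) + ε * (Q v2 v1 + D (W1 v2)))
      + (1 + (D v1) ^ 2) * (ε * (ε * (Q v2 v2 + D (W2 v2)))) = 0 := by
  have hG := contDiff_GF h1 h2
  have hT := contDiff_TF hG
  obtain ⟨dF1, eF1⟩ := fderiv_dir hu hG p
  obtain ⟨dF2, eF2⟩ := fderiv_dir hu hT p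
  set f1 : ℝ × ℝ → ℝ := fun q => fderiv ℝ u q (GF s11 s12 (q, u q)) with hf1
  set f2 : ℝ × ℝ → ℝ := fun q => fderiv ℝ u q (TF (GF s11 s12) (q, u q)) with hf2
  have eX1 : ∀ f q, X1 s11 s12 u f q = fderiv ℝ f q (GF s11 s12 (q, u q)) := by
    intro f q; rw [X1, VF_eq]; rfl
  have eX2 : ∀ f q, X2 s11 s12 ε u f q = ε * fderiv ℝ f q (TF (GF s11 s12) (q, u q)) := by
    intro f q; rw [X2, Yf, VF_eq, TF_GF h1 h2]
  have a1 : X1 s11 s12 u u = f1 := by funext q; rw [eX1]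
  have a2 : X2 s11 s12 ε u u = fun q => ε * f2 q := by funext q; rw [eX2]
  have aW : Wt s11 s12 ε u = fun q => Real.sqrt (1 + f1 q ^ 2 + (ε * f2 q) ^ 2) := by
    funext q
    rw [Wt, gradN, a1, a2, Real.sq_sqrt (by positivity), add_assoc]
  have dF2' : DifferentiableAt ℝ (fun q => ε * f2 q) p := dF2.const_mul ε
  have eF2' : ∀ ξ, fderiv ℝ (fun q => ε * f2 q) p ξ = ε * fderiv ℝ f2 p ξ := by
    intro ξ; rw [fderiv_const_mul dF2]; simp
  have b1 := quot_fderiv dF1 dF2' dF1 v1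
  have b2 := quot_fderiv dF1 dF2' dF2' v2
  simp only [eF2', eF1, eF2] at b1 b2
  rw [Lop, a1, a2, aW, eX1, eX2, ← hv1, ← hv2] at hL
  have c1 : f1 p = D v1 := by rw [hD, hv1]
  have c2 : f2 p = D v2 := by rw [hD, hv2]
  simp only [← hv1, ← hv2, ← hD, ← hW1, ← hW2, ← hQ, c1, c2] at b1 b2 hL
  set S := Real.sqrt (1 + D v1 ^ 2 + (ε * D v2) ^ 2)
  linear_combination (-1) * b1 - ε * b2 + S ^ 3 * hL

/-- Uniform approximation by smooth solutions of a perturbed degenerate equation. -/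
def AppSol (G : (ℝ × ℝ) × ℝ → ℝ × ℝ) (Ω : Set (ℝ × ℝ)) (u : ℝ × ℝ → ℝ) : Prop :=
  ∃ (U : ℕ → ℝ × ℝ → ℝ) (e : ℕ → ℝ) (l : ℝ), 0 < l ∧ (∀ n, 0 ≤ e n) ∧ Tendsto e atTop (𝓝 0) ∧
    (∀ n, ContDiff ℝ (⊤ : ℕ∞) (U n)) ∧ (∀ n, ∀ p ∈ Ω, ‖fderiv ℝ (U n) p‖ ≤ l) ∧
    (∀ p ∈ Ω, ∀ q ∈ Ω, |u p - u q| ≤ l * ‖p - q‖) ∧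
    (∀ K ⊆ Ω, IsCompact K → TendstoUniformlyOn U u atTop K) ∧
    ∀ n, ∀ p ∈ Ω, ∃ a2 a3 : ℝ × ℝ, ‖a2‖ ≤ e n ∧ ‖a3‖ ≤ e n ∧
      |fderiv ℝ (fderiv ℝ (U n)) p (G (p, U n p)) (G (p, U n p)) +
        fderiv ℝ (fderiv ℝ (U n)) p a2 a2 + fderiv ℝ (fderiv ℝ (U n)) p a3 a3 +
        fderiv ℝ (U n) p (fderiv ℝ G (p, U n p)
          (G (p, U n p), fderiv ℝ (U n) p (G (p, U n p))))| ≤ e n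

lemma AppSol.neg {G : (ℝ × ℝ) × ℝ → ℝ × ℝ} (hG : ContDiff ℝ (⊤ : ℕ∞) G)
    {Ω : Set (ℝ × ℝ)} {u : ℝ × ℝ → ℝ} (h : AppSol G Ω u) :
    AppSol (fun r => G (r.1, -r.2)) Ω (fun p => - u p) := by
  obtain ⟨U, e, l, hl, he, het, hU, hUl, hul, hc, hp⟩ := h
  have hd : ∀ n, fderiv ℝ (fun p => - U n p) = fun p => - fderiv ℝ (U n) p := by
    intro n; funext p; exact fderiv_fun_neg
  refine ⟨fun n p => - U n p, e, l, hl, he, het, fun n => (hU n).neg, ?_, ?_, ?_, ?_⟩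
  · intro n p hpΩ
    rw [hd]
    simpa using hUl n p hpΩ
  · intro p hpΩ q hq
    have := hul p hpΩ q hq
    rwa [← abs_neg, show -(-u p - -u q) = u p - u q by ring]
  · intro K hK hKc
    have := hc K hK hKc
    rw [Metric.tendstoUniformlyOn_iff] at this ⊢
    intro ε hε
    filter_upwards [this ε hε] with n hn x hx
    simpa using hn x hx
  · intro n p hpΩ
    obtain ⟨a2, a3, h2, h3, h⟩ := hp n p hpΩ
    refine ⟨a2, a3, h2, h3, ?_⟩
    have hd2 : fderiv ℝ (fderiv ℝ (fun p => - U n p)) p = - fderiv ℝ (fderiv ℝ (U n)) p := by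
      rw [hd]; exact fderiv_fun_neg
    have hA : HasFDerivAt (fun r : (ℝ × ℝ) × ℝ => (r.1, - r.2))
        ((ContinuousLinearMap.fst ℝ (ℝ × ℝ) ℝ).prod (-(ContinuousLinearMap.snd ℝ (ℝ × ℝ) ℝ)))
        (p, - U n p) :=
      ((ContinuousLinearMap.fst ℝ (ℝ × ℝ) ℝ).prod
        (-(ContinuousLinearMap.snd ℝ (ℝ × ℝ) ℝ))).hasFDerivAt
    have hB : HasFDerivAt G (fderiv ℝ G (p, U n p)) (p, - - U n p) := by
      rw [neg_neg]
      exact (hG.differentiable (by simp) _).hasFDerivAt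
    have hC := (HasFDerivAt.comp (p, - U n p) hB hA).fderiv
    have hC' : fderiv ℝ (fun r : (ℝ × ℝ) × ℝ => G (r.1, - r.2)) (p, - U n p) = _ := hC
    rw [hd2, hC', hd]
    simp only [neg_neg]
    rw [← abs_neg]
    convert h using 2
    simp
    ring

lemma pde_bound {ε B : ℝ} (ε0 : 0 < ε) (ε1 : ε ≤ 1) (hB1' : 1 ≤ B)
    (D : ℝ × ℝ →L[ℝ] ℝ) (Q : ℝ × ℝ →L[ℝ] ℝ × ℝ →L[ℝ] ℝ) (v1 v2 : ℝ × ℝ)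
    (W1 W2 : ℝ × ℝ → ℝ × ℝ) (nD : ∀ ξ, |D ξ| ≤ B * ‖ξ‖) (nv1 : ‖v1‖ ≤ B) (nv2 : ‖v2‖ ≤ B)
    (nW1 : ∀ ξ, ‖W1 ξ‖ ≤ B * ‖ξ‖) (nW2 : ∀ ξ, ‖W2 ξ‖ ≤ B * ‖ξ‖)
    (key : (1 + (ε * D v2) ^ 2) * (Q v1 v1 + D (W1 v1))
      - D v1 * (ε * D v2) * (ε * (Q v1 v2 + D (W2 v1)) + ε * (Q v2 v1 + D (W1 v2)))
      + (1 + (D v1) ^ 2) * (ε * (ε * (Q v2 v2 + D (W2 v2)))) = 0) :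
    ∃ a2 a3 : ℝ × ℝ, ‖a2‖ ≤ 5 * B ^ 7 * ε ∧ ‖a3‖ ≤ 5 * B ^ 7 * ε ∧
      |Q v1 v1 + Q a2 a2 + Q a3 a3 + D (W1 v1)| ≤ 5 * B ^ 7 * ε := by
  have hB0 : 0 ≤ B := by linarith
  have nDv : ∀ v : ℝ × ℝ, ‖v‖ ≤ B → |D v| ≤ B ^ 2 := fun v hv =>
    (nD v).trans (by nlinarith)
  have nDW1 : ∀ v : ℝ × ℝ, ‖v‖ ≤ B → |D (W1 v)| ≤ B ^ 3 := fun v hv =>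
    (nD _).trans (by
      have := (nW1 v).trans (mul_le_mul_of_nonneg_left hv hB0)
      calc B * ‖W1 v‖ ≤ B * (B * B) := mul_le_mul_of_nonneg_left this hB0
        _ = B ^ 3 := by ring)
  have nDW2 : ∀ v : ℝ × ℝ, ‖v‖ ≤ B → |D (W2 v)| ≤ B ^ 3 := fun v hv =>
    (nD _).trans (by
      have := (nW2 v).trans (mul_le_mul_of_nonneg_left hv hB0)
      calc B * ‖W2 v‖ ≤ B * (B * B) := mul_le_mul_of_nonneg_left this hB0
        _ = B ^ 3 := by ring)
  have d1 := nDv v1 nv1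
  have d2 := nDv v2 nv2
  have w11 := nDW1 v1 nv1
  have w12 := nDW1 v2 nv2
  have w21 := nDW2 v1 nv1
  have w22 := nDW2 v2 nv2
  have B13 : B ≤ B ^ 7 := le_self_pow₀ hB1' (by norm_num)
  have B37 : B ^ 3 ≤ B ^ 7 := pow_le_pow_right₀ hB1' (by norm_num)
  refine ⟨ε • v2, (ε * D v2) • v1 - (ε * D v1) • v2, ?_, ?_, ?_⟩
  · rw [norm_smul, Real.norm_eq_abs, abs_of_pos ε0]
    have f1 : ‖v2‖ ≤ 5 * B ^ 7 := nv2.trans (by linarith [pow_nonneg hB0 7])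
    calc ε * ‖v2‖ ≤ ε * (5 * B ^ 7) := mul_le_mul_of_nonneg_left f1 ε0.le
      _ = _ := by ring
  · refine (norm_sub_le _ _).trans ?_
    rw [norm_smul, norm_smul, Real.norm_eq_abs, Real.norm_eq_abs, abs_mul, abs_mul,
      abs_of_pos ε0]
    have e1 : |D v2| * ‖v1‖ ≤ B ^ 2 * B := mul_le_mul d2 nv1 (norm_nonneg _) (by positivity)
    have e2 : |D v1| * ‖v2‖ ≤ B ^ 2 * B := mul_le_mul d1 nv2 (norm_nonneg _) (by positivity)
    calc ε * |D v2| * ‖v1‖ + ε * |D v1| * ‖v2‖ = ε * (|D v2| * ‖v1‖ + |D v1| * ‖v2‖) := by ring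
      _ ≤ ε * (5 * B ^ 7) := by
        refine mul_le_mul_of_nonneg_left ?_ ε0.le
        have f2 : B ^ 2 * B = B ^ 3 := by ring
        linarith [pow_nonneg hB0 7]
      _ = _ := by ring
  · have expand : Q v1 v1 +
        Q (ε • v2) (ε • v2) +
        Q ((ε * D v2) • v1 - (ε * D v1) • v2)
          ((ε * D v2) • v1 - (ε * D v1) • v2) + D (W1 v1) =
        -(ε ^ 2 * ((D v2) ^ 2 * D (W1 v1) - D v1 * D v2 * (D (W2 v1) + D (W1 v2)) +
          (1 + (D v1) ^ 2) * D (W2 v2))) := by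
      simp only [map_sub, map_smul, sub_apply,
        smul_apply, smul_eq_mul]
      linear_combination key
    rw [expand, abs_neg, abs_mul, abs_of_nonneg (sq_nonneg ε)]
    have t1 : |(D v2) ^ 2 * D (W1 v1)| ≤ B ^ 7 := by
      rw [abs_mul, abs_pow]
      calc |D v2| ^ 2 * |D (W1 v1)| ≤ (B ^ 2) ^ 2 * B ^ 3 := by gcongr
        _ = B ^ 7 := by ring
    have t2 : |D v1 * D v2 * (D (W2 v1) + D (W1 v2))| ≤ 2 * B ^ 7 := by
      rw [abs_mul, abs_mul]
      have := abs_add_le (D (W2 v1)) (D (W1 v2))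
      calc |D v1| * |D v2| * |D (W2 v1) + D (W1 v2)| ≤ B ^ 2 * B ^ 2 * (B ^ 3 + B ^ 3) := by
            gcongr; linarith
        _ = 2 * B ^ 7 := by ring
    have t3 : |(1 + (D v1) ^ 2) * D (W2 v2)| ≤ 2 * B ^ 7 := by
      rw [abs_mul, abs_of_nonneg (by positivity : 0 ≤ 1 + (D v1) ^ 2), ← sq_abs (D v1)]
      calc (1 + |D v1| ^ 2) * |D (W2 v2)| ≤ (1 + (B ^ 2) ^ 2) * B ^ 3 := by gcongr
        _ = B ^ 3 + B ^ 7 := by ring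
        _ ≤ 2 * B ^ 7 := by linarith
    have t4 : |(D v2) ^ 2 * D (W1 v1) - D v1 * D v2 * (D (W2 v1) + D (W1 v2)) +
          (1 + (D v1) ^ 2) * D (W2 v2)| ≤ 5 * B ^ 7 := by
      refine (abs_add_le _ _).trans ?_
      have := abs_sub ((D v2) ^ 2 * D (W1 v1)) (D v1 * D v2 * (D (W2 v1) + D (W1 v2)))
      linarith
    have ε2 : ε ^ 2 ≤ ε := by nlinarith
    calc _ ≤ ε * (5 * B ^ 7) := mul_le_mul ε2 t4 (abs_nonneg _) ε0.le
      _ = _ := by ring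

set_option maxHeartbeats 1000000 in
lemma appSol_of_isVVSol {s11 s12 : ℝ × ℝ × ℝ → ℝ} (h1 : ContDiff ℝ (⊤ : ℕ∞) s11)
    (h2 : ContDiff ℝ (⊤ : ℕ∞) s12) {Ω : Set (ℝ × ℝ)} (hΩo : IsOpen Ω)
    (hΩb : Bornology.IsBounded Ω) {u : ℝ × ℝ → ℝ} {lu : NNReal} (hulip : LipschitzOnWith lu u Ω)
    (h : IsVVSol s11 s12 Ω u) : AppSol (GF s11 s12) Ω u := by
  obtain ⟨εs, us, l, hε, hεt, hus, hL, hlip, hbd, hconv⟩ := h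
  have hG := contDiff_GF h1 h2
  have hT := contDiff_TF hG
  set G := GF s11 s12 with hGdef
  have hfd : ∀ n, ∀ p ∈ Ω, ‖fderiv ℝ (us n) p‖ ≤ l := fun n p hp =>
    norm_fderiv_le_of_lipschitzOn ℝ (hΩo.mem_nhds hp) (hlip n)
  -- compact region
  have hK : IsCompact (closure Ω ×ˢ Set.Icc (-(l : ℝ)) l) :=
    (Metric.isCompact_of_isClosed_isBounded isClosed_closure hΩb.closure).prod isCompact_Icc
  have hmem : ∀ n, ∀ p ∈ Ω, (p, us n p) ∈ closure Ω ×ˢ Set.Icc (-(l : ℝ)) l := fun n p hp =>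
    ⟨subset_closure hp, abs_le.1 (hbd n p hp)⟩
  obtain ⟨B1, hB1⟩ := hK.exists_bound_of_continuousOn hG.continuous.continuousOn
  obtain ⟨B2, hB2⟩ := hK.exists_bound_of_continuousOn hT.continuous.continuousOn
  obtain ⟨B3, hB3⟩ := hK.exists_bound_of_continuousOn
    (hG.continuous_fderiv (by simp)).continuousOn
  obtain ⟨B4, hB4⟩ := hK.exists_bound_of_continuousOn
    (hT.continuous_fderiv (by simp)).continuousOn
  set B : ℝ := 1 + l + |B1| + |B2| + (|B3| + |B4|) * (1 + l) with hBdef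
  have hl0 : (0 : ℝ) ≤ l := l.2
  have p34 : 0 ≤ (|B3| + |B4|) * (1 + (l : ℝ)) := by positivity
  have a1 := abs_nonneg B1
  have a2 := abs_nonneg B2
  have a3 := abs_nonneg B3
  have a4 := abs_nonneg B4
  have hBl : (l : ℝ) ≤ B := by rw [hBdef]; linarith
  have hB1' : 1 ≤ B := by rw [hBdef]; linarith
  refine ⟨us, fun n => 5 * B ^ 7 * εs n, max 1 (max l lu), by positivity,
    fun n => mul_nonneg (by positivity) (hε n).1.le, ?_, hus, ?_, ?_, hconv, ?_⟩
  · simpa using hεt.const_mul (5 * B ^ 7)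
  · intro n p hp
    exact (hfd n p hp).trans ((le_max_left _ _).trans (le_max_right _ _))
  · intro p hp q hq
    have := hulip.dist_le_mul p hp q hq
    rw [Real.dist_eq, dist_eq_norm] at this
    refine this.trans (mul_le_mul_of_nonneg_right ?_ (norm_nonneg _))
    exact (le_max_right _ _).trans (le_max_right _ _)
  · intro n p hp
    obtain ⟨ε0, ε1⟩ := hε n
    set ε := εs n
    set D : ℝ × ℝ → ℝ := fun ξ => fderiv ℝ (us n) p ξ with hD
    set Q : ℝ × ℝ → ℝ × ℝ → ℝ := fun ξ η => fderiv ℝ (fderiv ℝ (us n)) p ξ η with hQ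
    set v1 := G (p, us n p) with hv1
    set v2 := TF G (p, us n p) with hv2
    set W1 : ℝ × ℝ → ℝ × ℝ := fun ξ => fderiv ℝ G (p, us n p) (ξ, D ξ) with hW1
    set W2 : ℝ × ℝ → ℝ × ℝ := fun ξ => fderiv ℝ (TF G) (p, us n p) (ξ, D ξ) with hW2
    have key := pde_point h1 h2 (hus n) ε p (hL n p hp) D (fun _ => rfl) Q (fun _ _ => rfl)
      v1 v2 hv1 hv2 W1 W2 (fun _ => rfl) (fun _ => rfl)
    have nv1 : ‖v1‖ ≤ B := (hB1 _ (hmem n p hp)).trans (by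
      have := le_abs_self B1; rw [hBdef]; linarith)
    have nv2 : ‖v2‖ ≤ B := (hB2 _ (hmem n p hp)).trans (by
      have := le_abs_self B2; rw [hBdef]; linarith)
    have nDl : ∀ ξ, |D ξ| ≤ l * ‖ξ‖ := fun ξ =>
      ((fderiv ℝ (us n) p).le_opNorm ξ).trans
        (mul_le_mul_of_nonneg_right (hfd n p hp) (norm_nonneg _))
    have nD : ∀ ξ, |D ξ| ≤ B * ‖ξ‖ := fun ξ => (nDl ξ).trans
      (mul_le_mul_of_nonneg_right hBl (norm_nonneg _))
    have npair : ∀ ξ : ℝ × ℝ, ‖(ξ, D ξ)‖ ≤ (1 + l) * ‖ξ‖ := by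
      intro ξ
      rw [Prod.norm_mk]
      have := nDl ξ
      have h0 := norm_nonneg ξ
      refine max_le (by nlinarith) ?_
      rw [Real.norm_eq_abs]
      nlinarith
    have nW1 : ∀ ξ, ‖W1 ξ‖ ≤ B * ‖ξ‖ := by
      intro ξ
      refine (ContinuousLinearMap.le_opNorm _ _).trans ?_
      have c1 := (hB3 _ (hmem n p hp)).trans (le_abs_self B3)
      refine (mul_le_mul c1 (npair ξ) (norm_nonneg _) a3).trans ?_
      rw [← mul_assoc]
      refine mul_le_mul_of_nonneg_right ?_ (norm_nonneg _)
      rw [hBdef]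
      nlinarith [mul_nonneg a4 hl0]
    have nW2 : ∀ ξ, ‖W2 ξ‖ ≤ B * ‖ξ‖ := by
      intro ξ
      refine (ContinuousLinearMap.le_opNorm _ _).trans ?_
      have c1 := (hB4 _ (hmem n p hp)).trans (le_abs_self B4)
      refine (mul_le_mul c1 (npair ξ) (norm_nonneg _) a4).trans ?_
      rw [← mul_assoc]
      refine mul_le_mul_of_nonneg_right ?_ (norm_nonneg _)
      rw [hBdef]
      nlinarith [mul_nonneg a3 hl0]
    exact pde_bound ε0 ε1 hB1' (fderiv ℝ (us n) p) (fderiv ℝ (fderiv ℝ (us n)) p) v1 v2 W1 W2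
      nD nv1 nv2 nW1 nW2 key

/-- Necessary conditions at a one-variable local maximum. -/
lemma second_test {f f' : ℝ → ℝ} {f'' : ℝ} (h1 : ∀ s, HasDerivAt f (f' s) s)
    (h2 : HasDerivAt f' f'' 0) (hm : IsLocalMax f 0) : f' 0 = 0 ∧ f'' ≤ 0 := by
  have h0 : f' 0 = 0 := hm.hasDerivAt_eq_zero (h1 0)
  refine ⟨h0, ?_⟩
  by_contra hpos
  push Not at hpos
  have hd : deriv f = f' := funext fun s => (h1 s).deriv
  have hmin : IsLocalMin f 0 := by
    refine isLocalMin_of_deriv_deriv_pos ?_ ?_ (h1 0).continuousAt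
    · rw [hd, h2.deriv]; exact hpos
    · rw [hd, h0]
  have hconst : f =ᶠ[𝓝 0] fun _ => f 0 := by
    filter_upwards [hm, hmin] with s a b using le_antisymm a b
  have e1 : deriv f =ᶠ[𝓝 0] fun _ => 0 := by
    have := hconst.deriv
    simpa using this
  have e2 := e1.deriv_eq
  rw [hd, h2.deriv] at e2
  simp at e2
  linarith

/-- First and second order conditions at the penalized maximum. -/
lemma max_conditions {V : ℝ × ℝ → ℝ} (hV : ContDiff ℝ (⊤ : ℕ∞) V) (x0 σ0 w : ℝ × ℝ)
    (u0 p κ N : ℝ) (xh : ℝ × ℝ) (th : ℝ)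
    (hm : IsLocalMax (fun y : (ℝ × ℝ) × ℝ => V y.1 - (u0 + p * y.2 - κ * y.2 ^ 2) -
      N * ((y.1.1 - (x0 + y.2 • σ0 + (y.2 ^ 2 / 2) • w).1) ^ 2 +
        (y.1.2 - (x0 + y.2 • σ0 + (y.2 ^ 2 / 2) • w).2) ^ 2)) (xh, th)) :
    p - 2 * κ * th = fderiv ℝ V xh (σ0 + th • w) ∧
    ∀ (a : ℝ × ℝ) (b : ℝ), fderiv ℝ (fderiv ℝ V) xh a a + 2 * κ * b ^ 2 -
      2 * N * ((a.1 - b * (σ0 + th • w).1) ^ 2 + (a.2 - b * (σ0 + th • w).2) ^ 2) +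
      b ^ 2 * fderiv ℝ V xh w ≤ 0 := by
  have hdV : ContDiff ℝ (⊤ : ℕ∞) (fderiv ℝ V) := hV.fderiv_right (by simp)
  have main : ∀ (a : ℝ × ℝ) (b : ℝ),
      fderiv ℝ V xh a - b * (p - 2 * κ * th) -
        2 * N * ((xh.1 - (x0.1 + th * σ0.1 + th ^ 2 / 2 * w.1)) * (a.1 - b * (σ0.1 + th * w.1)) +
          (xh.2 - (x0.2 + th * σ0.2 + th ^ 2 / 2 * w.2)) * (a.2 - b * (σ0.2 + th * w.2))) = 0 ∧
      fderiv ℝ (fderiv ℝ V) xh a a + 2 * κ * b ^ 2 -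
        2 * N * ((a.1 - b * (σ0.1 + th * w.1)) ^ 2 + (a.2 - b * (σ0.2 + th * w.2)) ^ 2) +
        b ^ 2 * (2 * N * ((xh.1 - (x0.1 + th * σ0.1 + th ^ 2 / 2 * w.1)) * w.1 +
          (xh.2 - (x0.2 + th * σ0.2 + th ^ 2 / 2 * w.2)) * w.2)) ≤ 0 := by
    intro a b
    have hline : ∀ s : ℝ, HasDerivAt (fun s : ℝ => xh + s • a) a s := by
      intro s
      simpa using ((hasDerivAt_id s).smul_const a).const_add xh
    have hT : ∀ s : ℝ, HasDerivAt (fun s : ℝ => th + s * b) b s := by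
      intro s
      simpa using ((hasDerivAt_id s).mul_const b).const_add th
    have hg : ∀ (X A x σ ω : ℝ) (s : ℝ), HasDerivAt
        (fun s : ℝ => X + s * A - (x + (th + s * b) * σ + (th + s * b) ^ 2 / 2 * ω))
        (A - b * (σ + (th + s * b) * ω)) s := by
      intro X A x σ ω s
      have e1 : HasDerivAt (fun s : ℝ => X + s * A) A s := by
        simpa using ((hasDerivAt_id s).mul_const A).const_add X
      have e2 := (((hT s).mul_const σ).const_add x).fun_add ((((hT s).fun_pow 2).div_const 2).mul_const ω)
      refine (e1.fun_sub e2).congr_deriv ?_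
      simp
      ring
    have hg' : ∀ (A σ ω : ℝ) (s : ℝ), HasDerivAt
        (fun s : ℝ => A - b * (σ + (th + s * b) * ω)) (-(b ^ 2 * ω)) s := by
      intro A σ ω s
      refine (((((hT s).mul_const ω).const_add σ).const_mul b).const_sub A).congr_deriv ?_
      ring
    have hq : ∀ s, HasDerivAt (fun s : ℝ => u0 + p * (th + s * b) - κ * (th + s * b) ^ 2)
        (b * (p - 2 * κ * (th + s * b))) s := by
      intro s
      refine ((((hT s).const_mul p).const_add u0).fun_sub (((hT s).fun_pow 2).const_mul κ)).congr_deriv ?_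
      simp
      ring
    have hq' : HasDerivAt (fun s : ℝ => b * (p - 2 * κ * (th + s * b))) (-(2 * κ * b ^ 2)) 0 := by
      refine ((((hT 0).const_mul (2 * κ)).const_sub p).const_mul b).congr_deriv ?_
      ring
    have hVl : ∀ s, HasDerivAt (fun s : ℝ => V (xh + s • a)) (fderiv ℝ V (xh + s • a) a) s :=
      fun s => ((hV.differentiable (by simp) (xh + s • a)).hasFDerivAt).comp_hasDerivAt s (hline s)
    have hVl' : HasDerivAt (fun s : ℝ => fderiv ℝ V (xh + s • a) a)
        (fderiv ℝ (fderiv ℝ V) xh a a) 0 := by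
      have e1 : HasFDerivAt (fderiv ℝ V) (fderiv ℝ (fderiv ℝ V) xh) (xh + (0 : ℝ) • a) := by
        rw [zero_smul, add_zero]
        exact (hdV.differentiable (by simp) xh).hasFDerivAt
      have e2 := e1.comp_hasDerivAt (0 : ℝ) (hline 0)
      have e3 := e2.clm_apply (hasDerivAt_const (0 : ℝ) a)
      simpa using e3
    have g1 := hg xh.1 a.1 x0.1 σ0.1 w.1
    have g2 := hg xh.2 a.2 x0.2 σ0.2 w.2
    have g1' := hg' a.1 σ0.1 w.1
    have g2' := hg' a.2 σ0.2 w.2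
    have H1 := fun s => ((hVl s).fun_sub (hq s)).fun_sub
      ((((g1 s).fun_pow 2).fun_add ((g2 s).fun_pow 2)).const_mul N)
    have H2 := (hVl'.fun_sub hq').fun_sub
      (((((g1 0).const_mul 2).fun_mul (g1' 0)).fun_add
        (((g2 0).const_mul 2).fun_mul (g2' 0))).const_mul N)
    have hloc : IsLocalMax (fun s : ℝ => V (xh + s • a) -
        (u0 + p * (th + s * b) - κ * (th + s * b) ^ 2) - N *
        ((xh.1 + s * a.1 - (x0.1 + (th + s * b) * σ0.1 + (th + s * b) ^ 2 / 2 * w.1)) ^ 2 +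
         (xh.2 + s * a.2 - (x0.2 + (th + s * b) * σ0.2 + (th + s * b) ^ 2 / 2 * w.2)) ^ 2)) 0 := by
      have hc : Tendsto (fun s : ℝ => (xh + s • a, th + s * b)) (𝓝 0) (𝓝 (xh, th)) := by
        have : Continuous (fun s : ℝ => (xh + s • a, th + s * b)) := by fun_prop
        simpa using this.tendsto 0
      have := hc.eventually hm
      filter_upwards [this] with s hs
      simpa using hs
    obtain ⟨r1, r2⟩ := second_test (fun s => (H1 s).congr_deriv (by
      show _ = (fderiv ℝ V (xh + s • a) a - b * (p - 2 * κ * (th + s * b))) - N *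
        (2 * (xh.1 + s * a.1 - (x0.1 + (th + s * b) * σ0.1 + (th + s * b) ^ 2 / 2 * w.1)) *
          (a.1 - b * (σ0.1 + (th + s * b) * w.1)) +
         2 * (xh.2 + s * a.2 - (x0.2 + (th + s * b) * σ0.2 + (th + s * b) ^ 2 / 2 * w.2)) *
          (a.2 - b * (σ0.2 + (th + s * b) * w.2)))
      simp)) H2 hloc
    simp only [zero_smul, zero_mul, add_zero] at r1 r2
    exact ⟨by linear_combination r1, by nlinarith [r2]⟩
  have hw := (main w 0).1
  have hc := (main (σ0 + th • w) 1).1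
  refine ⟨?_, fun a b => ?_⟩
  · simp at hc ⊢
    linarith
  · have h2 := (main a b).2
    have e : fderiv ℝ V xh w = 2 * N * ((xh.1 - (x0.1 + th * σ0.1 + th ^ 2 / 2 * w.1)) * w.1 +
          (xh.2 - (x0.2 + th * σ0.2 + th ^ 2 / 2 * w.2)) * w.2) := by
      simp only [zero_mul, sub_zero] at hw
      linarith
    rw [e]
    simpa using h2

lemma loc_bounds {G : (ℝ × ℝ) × ℝ → ℝ × ℝ} (hG : ContDiff ℝ (⊤ : ℕ∞) G) (z0 : (ℝ × ℝ) × ℝ) :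
    ∃ M : ℝ, 1 ≤ M ∧ ∀ z ∈ Metric.closedBall z0 1, ‖G z‖ ≤ M ∧ ‖fderiv ℝ G z‖ ≤ M ∧
      (∀ z' ∈ Metric.closedBall z0 1, ‖G z - G z'‖ ≤ M * ‖z - z'‖ ∧
        ‖fderiv ℝ G z - fderiv ℝ G z'‖ ≤ M * ‖z - z'‖) ∧
      ‖G z - G z0 - fderiv ℝ G z0 (z - z0)‖ ≤ M * ‖z - z0‖ ^ 2 := by
  have hdG : ContDiff ℝ (⊤ : ℕ∞) (fderiv ℝ G) := hG.fderiv_right (by simp)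
  have hK : IsCompact (Metric.closedBall z0 1) := isCompact_closedBall z0 1
  obtain ⟨B1, hB1⟩ := hK.exists_bound_of_continuousOn hG.continuous.continuousOn
  obtain ⟨B2, hB2⟩ := hK.exists_bound_of_continuousOn hdG.continuous.continuousOn
  obtain ⟨B3, hB3⟩ := hK.exists_bound_of_continuousOn
    (hdG.continuous_fderiv (by simp)).continuousOn
  set M := max 1 (max B1 (max B2 B3))
  have m1 : B1 ≤ M := (le_max_left _ _).trans (le_max_right _ _)
  have m2 : B2 ≤ M :=
    (le_max_left _ _).trans ((le_max_right B1 _).trans (le_max_right _ _))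
  have m3 : B3 ≤ M :=
    (le_max_right B2 _).trans ((le_max_right B1 _).trans (le_max_right _ _))
  have dl : ∀ z ∈ Metric.closedBall z0 1, ∀ z' ∈ Metric.closedBall z0 1,
      ‖fderiv ℝ G z - fderiv ℝ G z'‖ ≤ M * ‖z - z'‖ := fun z hz z' hz' =>
    (convex_closedBall z0 1).norm_image_sub_le_of_norm_fderiv_le
      (fun y _ => hdG.differentiable (by simp) y) (fun y hy => (hB3 y hy).trans m3) hz' hz
  have hM : 1 ≤ M := le_max_left _ _
  refine ⟨M, hM, fun z hz => ⟨(hB1 z hz).trans m1, (hB2 z hz).trans m2,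
    fun z' hz' => ⟨?_, dl z hz z' hz'⟩, ?_⟩⟩
  · exact (convex_closedBall z0 1).norm_image_sub_le_of_norm_fderiv_le
      (fun y _ => hG.differentiable (by simp) y) (fun y hy => (hB2 y hy).trans m2) hz' hz
  · have hz1 : ‖z - z0‖ ≤ 1 := by simpa [dist_eq_norm] using hz
    have key := (convex_closedBall z0 ‖z - z0‖).norm_image_sub_le_of_norm_hasFDerivWithin_le'
      (f := G) (f' := fderiv ℝ G) (φ := fderiv ℝ G z0) (C := M * ‖z - z0‖) (x := z0) (y := z)
      (fun y _ => (hG.differentiable (by simp) y).hasFDerivAt.hasFDerivWithinAt)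
      (fun y hy => by
        have hy' : ‖y - z0‖ ≤ ‖z - z0‖ := by simpa [dist_eq_norm] using hy
        refine (dl y ?_ z0 (by simp)).trans (mul_le_mul_of_nonneg_left hy' (by linarith))
        simpa [dist_eq_norm] using hy'.trans hz1)
      (by simp) (by simp [dist_eq_norm])
    calc _ ≤ M * ‖z - z0‖ * ‖z - z0‖ := key
      _ = _ := by ring

lemma ode_err {e e' : ℝ → ℝ × ℝ} {A M b : ℝ} (h0 : e 0 = 0) (hM : 0 ≤ M)
    (hd : ∀ t ∈ Set.uIcc 0 b, HasDerivAt e (e' t) t)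
    (hb : ∀ t ∈ Set.uIcc 0 b, ‖e' t‖ ≤ A + M * ‖e t‖) (hMb : M * |b| ≤ 1 / 2) :
    ∀ t ∈ Set.uIcc 0 b, ‖e t‖ ≤ 2 * |b| * A := by
  have hcont : ContinuousOn (fun t => ‖e t‖) (Set.uIcc 0 b) :=
    fun t ht => ((hd t ht).continuousAt.norm).continuousWithinAt
  obtain ⟨s, hs, hmax⟩ := isCompact_uIcc.exists_isMaxOn ⟨0, Set.left_mem_uIcc⟩ hcont
  have hmax' : ∀ t ∈ Set.uIcc 0 b, ‖e t‖ ≤ ‖e s‖ := fun t ht => hmax ht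
  have key := (convex_uIcc 0 b).norm_image_sub_le_of_norm_hasDerivWithin_le (f := e) (f' := e')
    (C := A + M * ‖e s‖) (x := 0) (y := s) (fun t ht => (hd t ht).hasDerivWithinAt)
    (fun t ht => (hb t ht).trans (by
      have := mul_le_mul_of_nonneg_left (hmax' t ht) hM; linarith)) Set.left_mem_uIcc hs
  rw [h0, sub_zero, sub_zero, Real.norm_eq_abs] at key
  have hsb : |s| ≤ |b| := by
    rcases Set.mem_uIcc.1 hs with ⟨h1, h2⟩ | ⟨h1, h2⟩
    · rw [abs_of_nonneg h1, abs_of_nonneg (h1.trans h2)]; exact h2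
    · rw [abs_of_nonpos h2, abs_of_nonpos (h1.trans h2)]; linarith
  have hpos : 0 ≤ A + M * ‖e s‖ := (norm_nonneg _).trans (hb s hs)
  have k2 : ‖e s‖ ≤ (A + M * ‖e s‖) * |b| := key.trans (mul_le_mul_of_nonneg_left hsb hpos)
  have k3 : M * |b| * ‖e s‖ ≤ 1 / 2 * ‖e s‖ := mul_le_mul_of_nonneg_right hMb (norm_nonneg _)
  intro t ht
  have := hmax' t ht
  nlinarith

/-- The quadratic comparison curve. -/
def cq (x0 σ0 w : ℝ × ℝ) (t : ℝ) : ℝ × ℝ := x0 + t • σ0 + (t ^ 2 / 2) • w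

/-- The quadratic comparison profile. -/
def qq (u0 p κ t : ℝ) : ℝ := u0 + p * t - κ * t ^ 2

lemma cq_hasDerivAt (x0 σ0 w : ℝ × ℝ) (t : ℝ) : HasDerivAt (cq x0 σ0 w) (σ0 + t • w) t := by
  have e1 := ((hasDerivAt_id t).smul_const σ0).const_add x0
  have e2 := (((hasDerivAt_id t).fun_pow 2).div_const 2).smul_const w
  refine (e1.fun_add e2).congr_deriv ?_
  simp

lemma curve_approx {G : (ℝ × ℝ) × ℝ → ℝ × ℝ} (hG : ContDiff ℝ (⊤ : ℕ∞) G) (x0 : ℝ × ℝ)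
    (u0 p κ : ℝ) (σ0 w : ℝ × ℝ) (hσ : σ0 = G (x0, u0)) (hw : w = fderiv ℝ G (x0, u0) (σ0, p)) :
    ∃ C : ℝ, 1 ≤ C ∧ ∀ t : ℝ, C * |t| ≤ 1 →
      ‖(cq x0 σ0 w t, qq u0 p κ t) - (x0, u0)‖ ≤ C * |t| ∧
      ‖(σ0 + t • w) - G (cq x0 σ0 w t, qq u0 p κ t)‖ ≤ C * t ^ 2 := by
  obtain ⟨M, hM1, hM⟩ := loc_bounds hG (x0, u0)
  set z0 : (ℝ × ℝ) × ℝ := (x0, u0) with hz0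
  set P : (ℝ × ℝ) × ℝ := (σ0, p) with hP
  set S : (ℝ × ℝ) × ℝ := ((1 / 2 : ℝ) • w, -κ) with hS
  set A := ‖P‖ + ‖S‖ + 1 with hA
  have hP0 := norm_nonneg P
  have hS0 := norm_nonneg S
  have hA1 : 1 ≤ A := by rw [hA]; linarith
  have hCA : A ≤ M * A ^ 2 := by nlinarith
  have hM0 : 0 ≤ M * A ^ 2 := by positivity
  have hMA : 0 ≤ M * A := by positivity
  refine ⟨M * A ^ 2 + M * A, by nlinarith, fun t ht => ?_⟩
  have hA2 : A ≤ M * A ^ 2 + M * A := by nlinarith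
  have htA : A * |t| ≤ 1 := (mul_le_mul_of_nonneg_right hA2 (abs_nonneg t)).trans ht
  have ht0 := abs_nonneg t
  have ht1 : |t| ≤ 1 := by nlinarith
  have hz : (cq x0 σ0 w t, qq u0 p κ t) - z0 = t • P + t ^ 2 • S := by
    rw [hz0, hP, hS, cq, qq]
    ext
    · simp; ring
    · simp; ring
    · simp; ring
  have n1 : ‖(cq x0 σ0 w t, qq u0 p κ t) - z0‖ ≤ A * |t| := by
    rw [hz]
    refine (norm_add_le _ _).trans ?_
    rw [norm_smul, norm_smul, Real.norm_eq_abs, Real.norm_eq_abs, abs_pow]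
    have : |t| ^ 2 ≤ |t| := by nlinarith
    have := mul_le_mul_of_nonneg_right this hS0
    rw [hA]
    nlinarith
  refine ⟨n1.trans (mul_le_mul_of_nonneg_right hA2 ht0), ?_⟩
  have hmem : (cq x0 σ0 w t, qq u0 p κ t) ∈ Metric.closedBall z0 1 := by
    rw [mem_closedBall_iff_norm]; exact n1.trans htA
  have h4 := (hM _ hmem).2.2.2
  have hd := (hM z0 (by simp)).2.1
  set Z := (cq x0 σ0 w t, qq u0 p κ t)
  have e1 : fderiv ℝ G z0 (Z - z0) = t • w + t ^ 2 • fderiv ℝ G z0 S := by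
    rw [hz, map_add, map_smul, map_smul, hw]
  have e2 : (σ0 + t • w) - G Z = -(G Z - G z0 - fderiv ℝ G z0 (Z - z0)) -
      t ^ 2 • fderiv ℝ G z0 S := by
    rw [e1, ← hσ]; abel
  rw [e2]
  refine (norm_sub_le _ _).trans ?_
  rw [norm_neg, norm_smul, Real.norm_eq_abs, abs_pow, sq_abs]
  have b1 : ‖Z - z0‖ ^ 2 ≤ A ^ 2 * t ^ 2 := by
    rw [← sq_abs t, ← mul_pow]
    exact pow_le_pow_left₀ (norm_nonneg _) n1 2
  have b2 : ‖fderiv ℝ G z0 S‖ ≤ M * A := by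
    refine ((fderiv ℝ G z0).le_opNorm S).trans ?_
    refine mul_le_mul hd (by rw [hA]; linarith) hS0 (by linarith)
  have b3 := mul_le_mul_of_nonneg_left b1 (by linarith : 0 ≤ M)
  have b4 := mul_le_mul_of_nonneg_left b2 (sq_nonneg t)
  nlinarith

lemma ev_small (A : ℝ) {B : ℝ} (hB : 0 < B) : ∀ᶠ d in 𝓝 (0 : ℝ), A * |d| < B := by
  have : Tendsto (fun d : ℝ => A * |d|) (𝓝 0) (𝓝 0) := by
    have h : Continuous (fun d : ℝ => A * |d|) := by fun_prop
    simpa using h.tendsto 0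
  exact this.eventually (gt_mem_nhds hB)

lemma ev_ball {P : ℝ → Prop} (h : ∀ᶠ t in 𝓝 (0 : ℝ), P t) :
    ∀ᶠ d in 𝓝 (0 : ℝ), ∀ t, |t| ≤ |d| → P t := by
  obtain ⟨r, hr, H⟩ := Metric.eventually_nhds_iff.1 h
  have := ev_small 1 hr
  filter_upwards [this] with d hd t ht
  apply H
  rw [Real.dist_eq, sub_zero]
  linarith

lemma abs_le_of_mem_uIcc {s b : ℝ} (hs : s ∈ Set.uIcc 0 b) : |s| ≤ |b| := by
  rcases Set.mem_uIcc.1 hs with ⟨h1, h2⟩ | ⟨h1, h2⟩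
  · rw [abs_of_nonneg h1, abs_of_nonneg (h1.trans h2)]; exact h2
  · rw [abs_of_nonpos h2, abs_of_nonpos (h1.trans h2)]; linarith

lemma barrier {G : (ℝ × ℝ) × ℝ → ℝ × ℝ} (hG : ContDiff ℝ (⊤ : ℕ∞) G) {Ω : Set (ℝ × ℝ)}
    (hΩ : IsOpen Ω) {u : ℝ × ℝ → ℝ} {l : ℝ} (hl : 0 < l)
    (hul : ∀ p ∈ Ω, ∀ q ∈ Ω, |u p - u q| ≤ l * ‖p - q‖) {γ : ℝ → ℝ × ℝ} {p κ : ℝ} (hκ : 0 < κ)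
    (hγΩ : ∀ᶠ t in 𝓝 (0 : ℝ), γ t ∈ Ω)
    (hγ : ∀ᶠ t in 𝓝 (0 : ℝ), HasDerivAt γ (G (γ t, u (γ t))) t)
    (htouch : ∀ᶠ t in 𝓝 (0 : ℝ), u (γ t) ≤ u (γ 0) + p * t - 2 * κ * t ^ 2)
    (x0 : ℝ × ℝ) (u0 : ℝ) (σ0 w : ℝ × ℝ) (hx0 : x0 = γ 0) (hu0 : u0 = u x0)
    (hσ : σ0 = G (x0, u0)) (hw : w = fderiv ℝ G (x0, u0) (σ0, p)) :
    ∃ C : ℝ, 0 < C ∧ ∀ᶠ d in 𝓝 (0 : ℝ), d ≠ 0 → ∃ b ∈ Set.uIcc 0 d,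
      u (cq x0 σ0 w b) - qq u0 p κ b ≤ -(κ * d ^ 2 / 2) ∧
      ∀ t ∈ Set.uIcc 0 b, u (cq x0 σ0 w t) - qq u0 p κ t ≤ C * d ^ 2 := by
  obtain ⟨M, hM1, hM⟩ := loc_bounds hG (x0, u0)
  obtain ⟨A, hA1, hA⟩ := curve_approx hG x0 u0 p κ σ0 w hσ hw
  have hx0Ω : x0 ∈ Ω := by rw [hx0]; exact hγΩ.self_of_nhds
  obtain ⟨R, hR, hRΩ⟩ := Metric.isOpen_iff.1 hΩ x0 hx0Ω
  -- linear bound on the displacement of γ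
  obtain ⟨Cg, hCg0, hCg⟩ : ∃ Cg : ℝ, 0 < Cg ∧ ∀ᶠ t in 𝓝 (0 : ℝ), ‖γ t - x0‖ ≤ Cg * |t| := by
    have h0 := hγ.self_of_nhds
    have := h0.isBigO_sub
    obtain ⟨c, hc, hc'⟩ := this.exists_pos
    refine ⟨c, hc, ?_⟩
    have hh := hc'.bound
    simp only [sub_zero, Real.norm_eq_abs, ← hx0] at hh
    exact hh
  set C3 := |p| + l * Cg with hC3
  have hC3p : 0 < C3 := by have := abs_nonneg p; positivity
  refine ⟨2 * l * (A + M * C3), by positivity, ?_⟩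
  filter_upwards [ev_ball hγΩ, ev_ball hγ, ev_ball htouch, ev_ball hCg, ev_small 1 one_pos,
    ev_small A one_pos, ev_small A hR, ev_small Cg one_pos, ev_small (l * Cg) one_pos,
    ev_small M (by norm_num : (0 : ℝ) < 1 / 2), ev_small (2 * l * M) (by norm_num : (0 : ℝ) < 1 / 4),
    ev_small (2 * l * A) (by positivity : 0 < κ / 4)]
    with d k1 k2 k3 k4 k5 k6 k7 k8 k9 k10 k11 k12 hd
  have hd0 : 0 < |d| := abs_pos.2 hd
  set δ := |d| with hδ
  have hd2 : d ^ 2 = δ ^ 2 := (sq_abs d).symm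
  have hin : ∀ t ∈ Set.uIcc 0 d, |t| ≤ δ := fun t ht => abs_le_of_mem_uIcc ht
  have hlip : ∀ t, |t| ≤ δ → |u (γ t) - u0| ≤ l * (Cg * |t|) := by
    intro t ht
    rw [hu0]
    exact (hul _ (k1 t ht) _ hx0Ω).trans (mul_le_mul_of_nonneg_left (k4 t ht) hl.le)
  set h : ℝ → ℝ := fun t => qq u0 p κ t - u (γ t) with hh
  have hlow : ∀ t, |t| ≤ δ → κ * t ^ 2 ≤ h t := by
    intro t ht
    have := k3 t ht
    rw [← hx0, ← hu0] at this
    simp only [hh, qq]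
    linarith
  have hup : ∀ t, |t| ≤ δ → h t ≤ C3 * δ := by
    intro t ht
    have e1 := abs_le.1 (hlip t ht)
    have e2 : p * t ≤ |p| * |t| := by rw [← abs_mul]; exact le_abs_self _
    have e3 : |p| * |t| ≤ |p| * δ := mul_le_mul_of_nonneg_left ht (abs_nonneg _)
    have e4 : l * (Cg * |t|) ≤ l * (Cg * δ) := by gcongr
    have e5 : 0 ≤ κ * t ^ 2 := by positivity
    simp only [hh, qq]
    rw [hC3]
    nlinarith [e1.1]
  have hcont : ContinuousOn h (Set.uIcc 0 d) := by
    have hu_cont : ContinuousOn u Ω := by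
      have : LipschitzOnWith ⟨l, hl.le⟩ u Ω := LipschitzOnWith.of_dist_le_mul (fun a ha b hb => by
        rw [Real.dist_eq, dist_eq_norm]; exact hul a ha b hb)
      exact this.continuousOn
    have hγc : ContinuousOn γ (Set.uIcc 0 d) := fun t ht =>
      (k2 t (hin t ht)).continuousAt.continuousWithinAt
    have : ContinuousOn (fun t => u (γ t)) (Set.uIcc 0 d) :=
      hu_cont.comp hγc (fun t ht => k1 t (hin t ht))
    refine ContinuousOn.sub ?_ this
    unfold qq
    fun_prop
  obtain ⟨b, hb, hbmax⟩ := isCompact_uIcc.exists_isMaxOn ⟨0, Set.left_mem_uIcc⟩ hcont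
  have hbmax' : ∀ t ∈ Set.uIcc 0 d, h t ≤ h b := fun t ht => hbmax ht
  have hsub : Set.uIcc 0 b ⊆ Set.uIcc 0 d := Set.uIcc_subset_uIcc_left hb
  have hbd : κ * δ ^ 2 ≤ h b := by
    rw [← hd2]
    exact (hlow d le_rfl).trans (hbmax' d Set.right_mem_uIcc)
  have hbδ : |b| ≤ δ := hin b hb
  have hb0 : 0 ≤ h b := le_trans (by positivity) hbd
  have hAt : ∀ t, |t| ≤ δ → A * |t| ≤ A * δ := fun t ht => mul_le_mul_of_nonneg_left ht (by linarith)
  have hball : ∀ t, |t| ≤ δ → (γ t, u (γ t)) ∈ Metric.closedBall (x0, u0) 1 := by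
    intro t ht
    rw [mem_closedBall_iff_norm, Prod.mk_sub_mk, Prod.norm_mk]
    have e1 : Cg * |t| ≤ Cg * δ := by gcongr
    have e2 : l * (Cg * |t|) ≤ l * Cg * δ := by rw [mul_assoc]; gcongr
    refine max_le ((k4 t ht).trans (by linarith)) ?_
    rw [Real.norm_eq_abs]
    exact (hlip t ht).trans (by linarith)
  have herr := ode_err (e := fun t => cq x0 σ0 w t - γ t)
    (e' := fun t => (σ0 + t • w) - G (γ t, u (γ t))) (A := A * δ ^ 2 + M * h b) (M := M) (b := b)
    (by simp [cq, hx0]) (by linarith)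
    (fun t ht => (cq_hasDerivAt x0 σ0 w t).fun_sub (k2 t (hin t (hsub ht))))
    (fun t ht => by
      have htδ := hin t (hsub ht)
      obtain ⟨a1, a2⟩ := hA t ((hAt t htδ).trans k6.le)
      have hm : (cq x0 σ0 w t, qq u0 p κ t) ∈ Metric.closedBall (x0, u0) 1 := by
        rw [mem_closedBall_iff_norm]; exact a1.trans ((hAt t htδ).trans k6.le)
      have a3 := ((hM _ hm).2.2.1 _ (hball t htδ)).1
      have a4 : ‖(cq x0 σ0 w t, qq u0 p κ t) - (γ t, u (γ t))‖ ≤ ‖cq x0 σ0 w t - γ t‖ + h b := by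
        rw [Prod.mk_sub_mk, Prod.norm_mk]
        have n0 := norm_nonneg (cq x0 σ0 w t - γ t)
        refine max_le (by linarith) ?_
        have h1 : 0 ≤ h t := le_trans (by positivity) (hlow t htδ)
        have h2 := hbmax' t (hsub ht)
        rw [Real.norm_eq_abs]
        change |h t| ≤ _
        rw [abs_of_nonneg h1]
        linarith
      have a5 : t ^ 2 ≤ δ ^ 2 := by rw [← sq_abs t]; exact pow_le_pow_left₀ (abs_nonneg _) htδ 2
      have a6 := mul_le_mul_of_nonneg_left a4 (by linarith : 0 ≤ M)
      have a7 := mul_le_mul_of_nonneg_left a5 (by linarith : 0 ≤ A)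
      have a8 := norm_sub_le_norm_sub_add_norm_sub (σ0 + t • w)
        (G (cq x0 σ0 w t, qq u0 p κ t)) (G (γ t, u (γ t)))
      change ‖(σ0 + t • w) - G (γ t, u (γ t))‖ ≤ A * δ ^ 2 + M * h b + M * ‖cq x0 σ0 w t - γ t‖
      linarith)
    ((mul_le_mul_of_nonneg_left hbδ (by linarith)).trans k10.le)
  have hmain : ∀ t ∈ Set.uIcc 0 b, u (cq x0 σ0 w t) - qq u0 p κ t ≤
      - h t + 2 * l * δ * (A * δ ^ 2 + M * h b) := by
    intro t ht
    have htδ := hin t (hsub ht)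
    obtain ⟨a1, -⟩ := hA t ((hAt t htδ).trans k6.le)
    have hcΩ : cq x0 σ0 w t ∈ Ω := by
      apply hRΩ
      rw [mem_ball_iff_norm]
      rw [Prod.mk_sub_mk] at a1
      exact lt_of_le_of_lt ((norm_fst_le _).trans a1) (lt_of_le_of_lt (hAt t htδ) k7)
    have a2 := (abs_le.1 (hul _ hcΩ _ (k1 t htδ))).2
    have a3 : ‖cq x0 σ0 w t - γ t‖ ≤ 2 * |b| * (A * δ ^ 2 + M * h b) := herr t ht
    have a4 : 2 * |b| * (A * δ ^ 2 + M * h b) ≤ 2 * δ * (A * δ ^ 2 + M * h b) := by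
      gcongr
    have a5 := mul_le_mul_of_nonneg_left (a3.trans a4) hl.le
    simp only [hh]
    linarith
  refine ⟨b, hb, ?_, fun t ht => ?_⟩
  · refine (hmain b Set.right_mem_uIcc).trans ?_
    rw [hd2]
    have e1 : 2 * l * M * δ * h b ≤ 1 / 4 * h b := mul_le_mul_of_nonneg_right k11.le hb0
    have e2 : 2 * l * A * δ * δ ^ 2 ≤ κ / 4 * δ ^ 2 := mul_le_mul_of_nonneg_right k12.le (sq_nonneg δ)
    nlinarith
  · refine (hmain t ht).trans ?_
    rw [hd2]
    have h1 : 0 ≤ h t := le_trans (by have := hκ; positivity) (hlow t (hin t (hsub ht)))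
    have h2 := hup b hbδ
    have e1 : A * δ ^ 2 ≤ A * δ := by
      have : δ ^ 2 ≤ δ := by nlinarith
      gcongr
    have e2 : M * h b ≤ M * (C3 * δ) := by gcongr
    have e3 : 2 * l * δ * (A * δ ^ 2 + M * h b) ≤ 2 * l * δ * (A * δ + M * (C3 * δ)) := by
      gcongr
    nlinarith

lemma max_point {Ω : Set (ℝ × ℝ)} {u : ℝ × ℝ → ℝ} {l κ C A R δ η b1 b2 : ℝ} (hl : 0 < l)
    (hκ : 0 < κ) (hC : 0 < C) (hA : 0 < A) (hδ : 0 < δ)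
    (hul : ∀ p ∈ Ω, ∀ q ∈ Ω, |u p - u q| ≤ l * ‖p - q‖) {x0 : ℝ × ℝ} (hR : 0 < R)
    (hRΩ : Metric.closedBall x0 R ⊆ Ω) {c : ℝ → ℝ × ℝ} {q : ℝ → ℝ} (hc : Continuous c)
    (hq : Continuous q) (hc0 : c 0 = x0) (hq0 : q 0 = u x0)
    (hcA : ∀ t, |t| ≤ δ → ‖c t - x0‖ ≤ A * δ) (hb1 : -δ ≤ b1) (hb1' : b1 ≤ 0) (hb2' : 0 ≤ b2)
    (hb2 : b2 ≤ δ) (hend1 : u (c b1) - q b1 ≤ -(κ * δ ^ 2 / 2))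
    (hend2 : u (c b2) - q b2 ≤ -(κ * δ ^ 2 / 2))
    (hmid : ∀ t ∈ Set.Icc b1 b2, u (c t) - q t ≤ C * δ ^ 2)
    {V : ℝ × ℝ → ℝ} (hV : Continuous V) (hη0 : 0 ≤ η) (hη1 : 16 * η ≤ κ * δ ^ 2) (hη2 : 2 * η ≤ δ ^ 2)
    (hVu : ∀ x ∈ Metric.closedBall x0 R, |V x - u x| ≤ η)
    {K N C4 : ℝ} (hK : K = l ^ 2 / κ) (hN : N = K / δ ^ 2) (hC4 : C4 = (l + C + 1) / K + 1)
    (hsmall : A * δ + C4 * δ ^ 2 < R) :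
    ∃ (xh : ℝ × ℝ) (th : ℝ), xh ∈ Ω ∧ |th| ≤ δ ∧ ‖xh - c th‖ ≤ C4 * δ ^ 2 ∧
      |V xh - q th| ≤ (C + 1 + l * C4) * δ ^ 2 ∧
      IsLocalMax (fun y : (ℝ × ℝ) × ℝ => V y.1 - q y.2 -
        N * ((y.1.1 - (c y.2).1) ^ 2 + (y.1.2 - (c y.2).2) ^ 2)) (xh, th) := by
  set Φ : (ℝ × ℝ) × ℝ → ℝ := fun y => V y.1 - q y.2 -
        N * ((y.1.1 - (c y.2).1) ^ 2 + (y.1.2 - (c y.2).2) ^ 2) with hΦ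
  have hKp : 0 < K := by rw [hK]; positivity
  have hNp : 0 < N := by rw [hN]; positivity
  have hδ2 : 0 < δ ^ 2 := by positivity
  have hNδ : N * δ ^ 2 = K := by rw [hN]; field_simp
  have hKκ : K * κ = l ^ 2 := by rw [hK]; field_simp
  have hΦc : Continuous Φ := by rw [hΦ]; fun_prop
  have hcomp : IsCompact (Metric.closedBall x0 R ×ˢ Set.Icc b1 b2) :=
    (isCompact_closedBall x0 R).prod isCompact_Icc
  have hne : (x0, (0 : ℝ)) ∈ Metric.closedBall x0 R ×ˢ Set.Icc b1 b2 :=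
    ⟨by simp [hR.le], hb1', hb2'⟩
  obtain ⟨⟨xh, th⟩, ⟨hxh, hth⟩, hmax⟩ := hcomp.exists_isMaxOn ⟨_, hne⟩ hΦc.continuousOn
  simp only at hxh hth
  have hthδ : |th| ≤ δ := abs_le.2 ⟨hb1.trans hth.1, hth.2.trans hb2⟩
  have hC4p : 0 < C4 := by rw [hC4]; positivity
  have hcR : ∀ t, |t| ≤ δ → c t ∈ Metric.closedBall x0 R := by
    intro t ht
    rw [mem_closedBall_iff_norm]
    have := hcA t ht
    have : 0 < C4 * δ ^ 2 := by positivity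
    linarith
  have hxΩ := hRΩ hxh
  have hx0b : x0 ∈ Metric.closedBall x0 R := by simp [hR.le]
  set d := ‖xh - c th‖ with hd
  have hd0 : 0 ≤ d := norm_nonneg _
  have hval : -η ≤ Φ (xh, th) := by
    have h1 : Φ (x0, 0) ≤ Φ (xh, th) := hmax hne
    have h2 : Φ (x0, 0) = V x0 - u x0 := by
      simp [hΦ, hc0, hq0]
    have := (abs_le.1 (hVu x0 hx0b)).1
    linarith
  have hsq : d ^ 2 ≤ (xh.1 - (c th).1) ^ 2 + (xh.2 - (c th).2) ^ 2 := by
    have : d = max |xh.1 - (c th).1| |xh.2 - (c th).2| := by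
      rw [hd, Prod.norm_def]; simp
    rw [this]
    rcases max_choice |xh.1 - (c th).1| |xh.2 - (c th).2| with h | h <;> rw [h, sq_abs] <;>
      nlinarith [sq_nonneg (xh.1 - (c th).1), sq_nonneg (xh.2 - (c th).2)]
  have hsq' := mul_le_mul_of_nonneg_left hsq hNp.le
  have hVx : V xh ≤ u (c th) + l * d + η := by
    have h1 := (abs_le.1 (hVu xh hxh)).2
    have h2 := (abs_le.1 (hul xh hxΩ _ (hRΩ (hcR th hthδ)))).2
    linarith
  have hΦv : Φ (xh, th) = V xh - q th -
        N * ((xh.1 - (c th).1) ^ 2 + (xh.2 - (c th).2) ^ 2) := rfl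
  have hmain : N * d ^ 2 ≤ (u (c th) - q th) + l * d + 2 * η := by linarith
  have hend : ¬ (u (c th) - q th ≤ -(κ * δ ^ 2 / 2)) := by
    intro hcon
    have e1 : l * d ≤ N * d ^ 2 + κ * δ ^ 2 / 4 := by
      -- 4 N (N d² + κ δ²/4 - l d) = (2 N d - l)² ≥ 0
      have e2 : N * (κ * δ ^ 2) = l ^ 2 := by
        rw [← hKκ, ← hNδ]; ring
      have e3 : 0 ≤ 4 * N * (N * d ^ 2 + κ * δ ^ 2 / 4 - l * d) := by
        have e5 : 4 * N * (N * d ^ 2 + κ * δ ^ 2 / 4 - l * d) = (2 * N * d - l) ^ 2 := by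
          linear_combination e2
        rw [e5]; exact sq_nonneg _
      have e4 := nonneg_of_mul_nonneg_right e3 (by positivity : 0 < 4 * N)
      linarith
    have := mul_pos hκ hδ2
    linarith
  have hd4 : d ≤ C4 * δ ^ 2 := by
    by_contra hcon
    push Not at hcon
    have h1 := hmid th hth
    have h2 : K * C4 = l + C + 1 + K := by rw [hC4]; field_simp
    have hC41 : 1 ≤ C4 := by
      rw [hC4]; have : 0 < (l + C + 1) / K := by positivity
      linarith
    have h3 : δ ^ 2 ≤ d := by
      have := mul_le_mul_of_nonneg_right hC41 hδ2.le
      linarith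
    have h4 : N * d ^ 2 ≥ N * (C4 * δ ^ 2) * d := by
      have := mul_le_mul_of_nonneg_left hcon.le (by positivity : 0 ≤ N * d)
      calc N * (C4 * δ ^ 2) * d = N * d * (C4 * δ ^ 2) := by ring
        _ ≤ N * d * d := this
        _ = N * d ^ 2 := by ring
    have h5 : N * (C4 * δ ^ 2) = l + C + 1 + K := by rw [← h2, ← hNδ]; ring
    rw [h5] at h4
    have hdp : 0 < d := by linarith
    have h6 := mul_pos hKp hdp
    have h7 := mul_le_mul_of_nonneg_left h3 hC.le
    have h8 : (l + C + 1 + K) * d = l * d + C * d + d + K * d := by ring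
    linarith
  have hthI : th ∈ Set.Ioo b1 b2 := by
    refine ⟨lt_of_le_of_ne hth.1 ?_, lt_of_le_of_ne hth.2 ?_⟩
    · rintro rfl; exact hend hend1
    · rintro rfl; exact hend hend2
  have hxI : xh ∈ Metric.ball x0 R := by
    rw [mem_ball_iff_norm]
    have := norm_sub_le_norm_sub_add_norm_sub xh (c th) x0
    have := hcA th hthδ
    linarith
  refine ⟨xh, th, hxΩ, hthδ, hd4, ?_, ?_⟩
  · have h1 := hmid th hth
    have h2 : l * d ≤ l * (C4 * δ ^ 2) := mul_le_mul_of_nonneg_left hd4 hl.le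
    have h3 : 0 ≤ N * ((xh.1 - (c th).1) ^ 2 + (xh.2 - (c th).2) ^ 2) := by positivity
    have h4 : 0 ≤ l * (C4 * δ ^ 2) := by positivity
    have h5 : 0 < C * δ ^ 2 := by positivity
    rw [abs_le]
    constructor
    · linarith
    · linarith
  · have hnhds : Metric.closedBall x0 R ×ˢ Set.Icc b1 b2 ∈ 𝓝 (xh, th) :=
      prod_mem_nhds (Filter.mem_of_superset (Metric.isOpen_ball.mem_nhds hxI)
        Metric.ball_subset_closedBall) (Icc_mem_nhds hthI.1 hthI.2)
    exact hmax.isLocalMax hnhds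

lemma norm_sq_bound (a : ℝ × ℝ) {r : ℝ} (h : ‖a‖ ≤ r) : a.1 ^ 2 + a.2 ^ 2 ≤ 2 * r ^ 2 := by
  have h1 : |a.1| ≤ r := (norm_fst_le a).trans h
  have h2 : |a.2| ≤ r := (norm_snd_le a).trans h
  have h3 := pow_le_pow_left₀ (abs_nonneg _) h1 2
  have h4 := pow_le_pow_left₀ (abs_nonneg _) h2 2
  rw [sq_abs] at h3 h4
  linarith

/-- The pointwise estimate at the penalized maximum. -/
lemma point_estimate {G : (ℝ × ℝ) × ℝ → ℝ × ℝ} {z0 : (ℝ × ℝ) × ℝ} {M : ℝ} (hM1 : 1 ≤ M)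
    (hM : ∀ z ∈ Metric.closedBall z0 1, ‖G z‖ ≤ M ∧ ‖fderiv ℝ G z‖ ≤ M ∧
      (∀ z' ∈ Metric.closedBall z0 1, ‖G z - G z'‖ ≤ M * ‖z - z'‖ ∧
        ‖fderiv ℝ G z - fderiv ℝ G z'‖ ≤ M * ‖z - z'‖))
    {D : ℝ × ℝ →L[ℝ] ℝ} {Q : ℝ × ℝ →L[ℝ] ℝ × ℝ →L[ℝ] ℝ} {l κ p N K C A δ e t : ℝ} (hl : 0 < l)
    (hκ : 0 < κ) (hδ : 0 < δ) (hδ1 : δ ≤ 1) (hN0 : 0 ≤ N) (hN : N * δ ^ 2 = K) (hC : 0 < C)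
    (hA : 0 < A)
    (he : 0 ≤ e) (hD : ‖D‖ ≤ l) {z zc : (ℝ × ℝ) × ℝ} {cd w a2 a3 : ℝ × ℝ}
    (hz : z ∈ Metric.closedBall z0 1) (hzc : zc ∈ Metric.closedBall z0 1)
    (hzz : ‖z - zc‖ ≤ C * δ ^ 2) (hzc0 : ‖zc - z0‖ ≤ A * δ) (hcd : ‖cd - G zc‖ ≤ A * δ ^ 2)
    (ht : |t| ≤ δ) (hw : w = fderiv ℝ G z0 (G z0, p)) (h1 : p - 2 * κ * t = D cd)
    (h2 : ∀ (a : ℝ × ℝ) (b : ℝ), Q a a + 2 * κ * b ^ 2 -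
      2 * N * ((a.1 - b * cd.1) ^ 2 + (a.2 - b * cd.2) ^ 2) + b ^ 2 * D w ≤ 0)
    (ha2 : ‖a2‖ ≤ e) (ha3 : ‖a3‖ ≤ e)
    (hpde : |Q (G z) (G z) + Q a2 a2 + Q a3 a3 + D (fderiv ℝ G z (G z, D (G z)))| ≤ e) :
    2 * κ ≤ e + 8 * N * e ^ 2 + (4 * K * (M * C + A) ^ 2 +
      l * (M * (C + A) * (M + l * M) + M * (M * (C + A) + 2 * κ + l * (M * C + A)))) * δ := by
  have hM0 : 0 ≤ M := by linarith
  have hδ2 : δ ^ 2 ≤ δ := by nlinarith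
  obtain ⟨g1, g2, g3⟩ := hM z hz
  have hz0m : z0 ∈ Metric.closedBall z0 1 := by simp
  have nD : ∀ ξ, |D ξ| ≤ l * ‖ξ‖ := fun ξ => (D.le_opNorm ξ).trans
    (mul_le_mul_of_nonneg_right hD (norm_nonneg _))
  have s1 : ‖G z - cd‖ ≤ (M * C + A) * δ ^ 2 := by
    have := norm_sub_le_norm_sub_add_norm_sub (G z) (G zc) cd
    rw [norm_sub_rev (G zc) cd] at this
    have a1 := (g3 zc hzc).1
    have a2 := mul_le_mul_of_nonneg_left hzz hM0
    linarith
  have zz0 : ‖z - z0‖ ≤ (C + A) * δ := by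
    have := norm_sub_le_norm_sub_add_norm_sub z zc z0
    have := mul_le_mul_of_nonneg_left hδ2 hC.le
    linarith
  have s2 : ‖G z - G z0‖ ≤ M * (C + A) * δ := by
    have := (g3 z0 hz0m).1
    have := mul_le_mul_of_nonneg_left zz0 hM0
    linarith
  have s3 : ‖fderiv ℝ G z - fderiv ℝ G z0‖ ≤ M * (C + A) * δ := by
    have := (g3 z0 hz0m).2
    have := mul_le_mul_of_nonneg_left zz0 hM0
    linarith
  have s4 : |D (G z) - p| ≤ (2 * κ + l * (M * C + A)) * δ := by
    have e1 : D (G z) - p = D (G z - cd) - 2 * κ * t := by rw [map_sub]; linarith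
    rw [e1]
    refine (abs_sub _ _).trans ?_
    have e2 := nD (G z - cd)
    have e3 := mul_le_mul_of_nonneg_left s1 hl.le
    have e4 : |2 * κ * t| ≤ 2 * κ * δ := by
      rw [abs_mul, abs_of_pos (by positivity : 0 < 2 * κ)]
      exact mul_le_mul_of_nonneg_left ht (by positivity)
    have e5 : l * ((M * C + A) * δ ^ 2) ≤ l * ((M * C + A) * δ) := by gcongr
    nlinarith
  have s5 : ‖(G z, D (G z))‖ ≤ M + l * M := by
    rw [Prod.norm_mk]
    have e1 : 0 ≤ l * M := by positivity
    have e2 := nD (G z)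
    have e3 := mul_le_mul_of_nonneg_left g1 hl.le
    refine max_le (by linarith) ?_
    rw [Real.norm_eq_abs]
    linarith
  have s6 : ‖(G z, D (G z)) - (G z0, p)‖ ≤
      (M * (C + A) + 2 * κ + l * (M * C + A)) * δ := by
    rw [Prod.mk_sub_mk, Prod.norm_mk]
    have e1 : 0 ≤ (2 * κ + l * (M * C + A)) * δ := by positivity
    have e2 : 0 ≤ M * (C + A) * δ := by positivity
    refine max_le (by linarith) ?_
    rw [Real.norm_eq_abs]
    linarith
  have s7 : ‖fderiv ℝ G z (G z, D (G z)) - w‖ ≤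
      (M * (C + A) * (M + l * M) + M * (M * (C + A) + 2 * κ + l * (M * C + A))) * δ := by
    have e1 : fderiv ℝ G z (G z, D (G z)) - w =
        (fderiv ℝ G z - fderiv ℝ G z0) (G z, D (G z)) +
        fderiv ℝ G z0 ((G z, D (G z)) - (G z0, p)) := by
      rw [hw, map_sub, sub_apply]; abel
    rw [e1]
    refine (norm_add_le _ _).trans ?_
    have e2 := ((fderiv ℝ G z - fderiv ℝ G z0).le_opNorm (G z, D (G z))).trans
      (mul_le_mul s3 s5 (norm_nonneg _) (by positivity))
    have e3 := ((fderiv ℝ G z0).le_opNorm ((G z, D (G z)) - (G z0, p))).trans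
      (mul_le_mul (hM z0 hz0m).2.1 s6 (norm_nonneg _) hM0)
    linarith
  have s8 : |D (fderiv ℝ G z (G z, D (G z)) - w)| ≤ l * ((M * (C + A) * (M + l * M) +
      M * (M * (C + A) + 2 * κ + l * (M * C + A))) * δ) :=
    (nD _).trans (mul_le_mul_of_nonneg_left s7 hl.le)
  rw [map_sub] at s8
  have q1 := h2 (G z) 1
  have q2 := h2 a2 0
  have q3 := h2 a3 0
  simp only [one_mul, zero_mul, sub_zero, one_pow, ne_eq, OfNat.ofNat_ne_zero, not_false_eq_true,
    zero_pow, mul_zero, add_zero, mul_one] at q1 q2 q3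
  have r1 := mul_le_mul_of_nonneg_left (norm_sq_bound (G z - cd) s1) (by positivity : 0 ≤ 2 * N)
  have r2 := mul_le_mul_of_nonneg_left (norm_sq_bound a2 ha2) (by positivity : 0 ≤ 2 * N)
  have r3 := mul_le_mul_of_nonneg_left (norm_sq_bound a3 ha3) (by positivity : 0 ≤ 2 * N)
  simp only [Prod.fst_sub, Prod.snd_sub] at r1
  have r4 : 2 * N * (2 * ((M * C + A) * δ ^ 2) ^ 2) = 4 * K * (M * C + A) ^ 2 * δ ^ 2 := by
    rw [← hN]; ring
  have hK0 : 0 ≤ K := by rw [← hN]; positivity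
  have r5 : 4 * K * (M * C + A) ^ 2 * δ ^ 2 ≤ 4 * K * (M * C + A) ^ 2 * δ := by gcongr
  have r6 := (abs_le.1 hpde).1
  have r7 := (abs_le.1 s8).2
  linarith

lemma no_touch {G : (ℝ × ℝ) × ℝ → ℝ × ℝ} (hG : ContDiff ℝ (⊤ : ℕ∞) G) {Ω : Set (ℝ × ℝ)}
    (hΩ : IsOpen Ω) {u : ℝ × ℝ → ℝ} (hsol : AppSol G Ω u) {γ : ℝ → ℝ × ℝ} {p κ : ℝ} (hκ : 0 < κ)
    (hγΩ : ∀ᶠ t in 𝓝 (0 : ℝ), γ t ∈ Ω)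
    (hγ : ∀ᶠ t in 𝓝 (0 : ℝ), HasDerivAt γ (G (γ t, u (γ t))) t)
    (htouch : ∀ᶠ t in 𝓝 (0 : ℝ), u (γ t) ≤ u (γ 0) + p * t - 2 * κ * t ^ 2) : False := by
  obtain ⟨U, e, l, hl, he, het, hU, hUl, hul, hconv, hp⟩ := hsol
  obtain ⟨x0, hx0⟩ : ∃ x0, x0 = γ 0 := ⟨_, rfl⟩
  obtain ⟨u0, hu0⟩ : ∃ u0, u0 = u x0 := ⟨_, rfl⟩
  obtain ⟨σ0, hσ⟩ : ∃ σ0, σ0 = G (x0, u0) := ⟨_, rfl⟩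
  obtain ⟨w, hw⟩ : ∃ w, w = fderiv ℝ G (x0, u0) (σ0, p) := ⟨_, rfl⟩
  obtain ⟨C, hC, hbar⟩ := barrier hG hΩ hl hul hκ hγΩ hγ htouch x0 u0 σ0 w hx0 hu0 hσ hw
  obtain ⟨M, hM1, hM⟩ := loc_bounds hG (x0, u0)
  obtain ⟨A, hA1, hA⟩ := curve_approx hG x0 u0 p κ σ0 w hσ hw
  have hx0Ω : x0 ∈ Ω := by rw [hx0]; exact hγΩ.self_of_nhds
  obtain ⟨R, hR, hRΩ⟩ := Metric.nhds_basis_closedBall.mem_iff.1 (hΩ.mem_nhds hx0Ω)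
  obtain ⟨K, hK⟩ : ∃ K, K = l ^ 2 / κ := ⟨_, rfl⟩
  obtain ⟨C4, hC4⟩ : ∃ C4, C4 = (l + C + 1) / K + 1 := ⟨_, rfl⟩
  have hKp : 0 < K := by rw [hK]; positivity
  have hC4p : 0 < C4 := by rw [hC4]; positivity
  have hA0 : 0 < A := by linarith
  set C5 := C4 + (C + 1 + l * C4) with hC5
  have hC5p : 0 < C5 := by positivity
  set Fin := 4 * K * (M * C5 + A) ^ 2 +
      l * (M * (C5 + A) * (M + l * M) + M * (M * (C5 + A) + 2 * κ + l * (M * C5 + A))) with hFin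
  have hbar' : ∀ᶠ d in 𝓝 (0 : ℝ), -d ≠ 0 → ∃ b ∈ Set.uIcc 0 (-d),
      u (cq x0 σ0 w b) - qq u0 p κ b ≤ -(κ * (-d) ^ 2 / 2) ∧
      ∀ t ∈ Set.uIcc 0 b, u (cq x0 σ0 w t) - qq u0 p κ t ≤ C * (-d) ^ 2 := by
    have : Tendsto (fun d : ℝ => -d) (𝓝 0) (𝓝 0) := by
      simpa using (continuous_neg (G := ℝ)).tendsto 0
    exact this.eventually hbar
  have hev : ∀ᶠ δ in 𝓝[>] (0 : ℝ), _ := ((hbar.and hbar').and ((ev_small 1 one_pos).and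
    ((ev_small (A + C4) hR).and ((ev_small (A + C5) one_pos).and
      (ev_small Fin hκ))))).filter_mono nhdsWithin_le_nhds
  obtain ⟨δ, ⟨⟨k1, k2⟩, k3, k4, k5, k6⟩, hδ⟩ := (hev.and self_mem_nhdsWithin).exists
  have hδ : 0 < δ := hδ
  rw [abs_of_pos hδ] at k3 k4 k5 k6
  obtain ⟨b2, hb2, hend2, hmid2⟩ := k1 hδ.ne'
  obtain ⟨b1, hb1, hend1, hmid1⟩ := k2 (by linarith)
  rw [neg_sq] at hend1 hmid1
  rw [Set.uIcc_of_le hδ.le] at hb2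
  rw [Set.uIcc_of_ge (by linarith)] at hb1
  rw [Set.uIcc_of_le hb2.1] at hmid2
  rw [Set.uIcc_of_ge hb1.2] at hmid1
  have hmid : ∀ t ∈ Set.Icc b1 b2, u (cq x0 σ0 w t) - qq u0 p κ t ≤ C * δ ^ 2 := by
    intro t ht
    rcases le_total 0 t with h | h
    · exact hmid2 t ⟨h, ht.2⟩
    · exact hmid1 t ⟨ht.1, h⟩
  have hδ1 : δ ≤ 1 := by linarith
  have hδ2 : δ ^ 2 ≤ δ := by nlinarith
  have hAδ : A * δ ≤ 1 := by nlinarith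
  have hAt : ∀ t, |t| ≤ δ → A * |t| ≤ A * δ := fun t ht => mul_le_mul_of_nonneg_left ht hA0.le
  obtain ⟨N, hN⟩ : ∃ N, N = K / δ ^ 2 := ⟨_, rfl⟩
  have hNδ : N * δ ^ 2 = K := by rw [hN]; field_simp
  have hNp : 0 < N := by rw [hN]; positivity
  obtain ⟨η, hη⟩ : ∃ η, η = min (κ * δ ^ 2 / 16) (δ ^ 2 / 2) := ⟨_, rfl⟩
  have hηp : 0 < η := by rw [hη]; positivity
  have hη1 : 16 * η ≤ κ * δ ^ 2 := by
    have := min_le_left (κ * δ ^ 2 / 16) (δ ^ 2 / 2); rw [← hη] at this; linarith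
  have hη2 : 2 * η ≤ δ ^ 2 := by
    have := min_le_right (κ * δ ^ 2 / 16) (δ ^ 2 / 2); rw [← hη] at this; linarith
  have hun := (Metric.tendstoUniformlyOn_iff.1 (hconv _ hRΩ (isCompact_closedBall x0 R))) η hηp
  have hen : ∀ᶠ n in atTop, e n + 8 * N * e n ^ 2 < κ := by
    have : Tendsto (fun n => e n + 8 * N * e n ^ 2) atTop (𝓝 0) := by
      simpa using het.add ((het.pow 2).const_mul (8 * N))
    exact this.eventually (gt_mem_nhds hκ)
  obtain ⟨n, hn1, hn2⟩ := (hun.and hen).exists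
  have hccont : Continuous (cq x0 σ0 w) :=
    continuous_iff_continuousAt.2 fun t => (cq_hasDerivAt x0 σ0 w t).continuousAt
  have hqcont : Continuous (qq u0 p κ) := by unfold qq; fun_prop
  obtain ⟨xh, th, hxΩ, hth, hd, hv, hmax⟩ := max_point (c := cq x0 σ0 w) (q := qq u0 p κ)
    hl hκ hC hA0 hδ hul hR hRΩ hccont hqcont
    (by simp [cq]) (by simp [qq, hu0])
    (fun t ht => by
      obtain ⟨a1, -⟩ := hA t ((hAt t ht).trans hAδ)
      rw [Prod.mk_sub_mk] at a1
      exact ((norm_fst_le _).trans a1).trans (hAt t ht))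
    hb1.1 hb1.2 hb2.1 hb2.2 hend1 hend2 hmid (hU n).continuous hηp.le hη1 hη2
    (fun x hx => by
      have := hn1 x hx
      rw [dist_comm, Real.dist_eq] at this
      exact this.le) hK hN hC4 (by
        have := mul_le_mul_of_nonneg_left hδ2 hC4p.le
        linarith)
  obtain ⟨m1, m2⟩ := max_conditions (hU n) x0 σ0 w u0 p κ N xh th hmax
  obtain ⟨a2, a3, ha2, ha3, hpde⟩ := hp n xh hxΩ
  obtain ⟨c1, c2⟩ := hA th ((hAt th hth).trans hAδ)
  have c1' := c1.trans (hAt th hth)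
  have hth2 : th ^ 2 ≤ δ ^ 2 := by rw [← sq_abs th]; exact pow_le_pow_left₀ (abs_nonneg _) hth 2
  have hzz : ‖(xh, U n xh) - (cq x0 σ0 w th, qq u0 p κ th)‖ ≤ C5 * δ ^ 2 := by
    rw [Prod.mk_sub_mk, Prod.norm_mk, Real.norm_eq_abs]
    have e1 : 0 ≤ C4 * δ ^ 2 := by positivity
    have e2 : 0 ≤ (C + 1 + l * C4) * δ ^ 2 := by positivity
    rw [hC5, add_mul]
    exact max_le (by linarith) (by linarith)
  have hzc : (cq x0 σ0 w th, qq u0 p κ th) ∈ Metric.closedBall (x0, u0) 1 := by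
    rw [mem_closedBall_iff_norm]; linarith
  have hz : (xh, U n xh) ∈ Metric.closedBall (x0, u0) 1 := by
    rw [mem_closedBall_iff_norm]
    have e1 := norm_sub_le_norm_sub_add_norm_sub (xh, U n xh) (cq x0 σ0 w th, qq u0 p κ th) (x0, u0)
    have e2 := mul_le_mul_of_nonneg_left hδ2 hC5p.le
    linarith
  have final := point_estimate (G := G) (z0 := (x0, u0)) (M := M) (C := C5) (A := A) hM1
    (fun z hz => ⟨(hM z hz).1, (hM z hz).2.1, (hM z hz).2.2.1⟩)
    hl hκ hδ hδ1 hNp.le hNδ hC5p hA0 (he n) (hUl n xh hxΩ) hz hzc hzz c1'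
    (c2.trans (mul_le_mul_of_nonneg_left hth2 hA0.le)) hth (by rw [hw, hσ]) m1 m2 ha2 ha3 hpde
  rw [← hFin] at final
  linarith

/-- A continuous function that cannot be touched from above by concave parabolas lies
below its chords. -/
lemma below_chord {g : ℝ → ℝ} {a b : ℝ} (hab : a < b) (hg : ContinuousOn g (Set.Icc a b))
    (hno : ∀ t ∈ Set.Ioo a b, ∀ p κ : ℝ, 0 < κ →
      ¬ ∀ᶠ s in 𝓝 (0 : ℝ), g (t + s) ≤ g t + p * s - 2 * κ * s ^ 2) :
    ∀ z ∈ Set.Icc a b, g z ≤ g a + (g b - g a) / (b - a) * (z - a) := by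
  intro z hz
  by_contra hcon
  push Not at hcon
  set m := (g b - g a) / (b - a) with hm
  have hmb : m * (b - a) = g b - g a := by
    rw [hm]; field_simp [sub_ne_zero.2 hab.ne']
  set gap := g z - (g a + m * (z - a)) with hgap
  have hgap0 : 0 < gap := by linarith
  have hzz : 0 ≤ (z - a) * (b - z) := mul_nonneg (by linarith [hz.1]) (by linarith [hz.2])
  obtain ⟨μ, hμ0, hμ⟩ : ∃ μ : ℝ, 0 < μ ∧ μ * ((z - a) * (b - z)) < gap := by
    refine ⟨gap / (1 + (z - a) * (b - z)), by positivity, ?_⟩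
    rw [div_mul_eq_mul_div, div_lt_iff₀ (by positivity)]
    nlinarith
  set f : ℝ → ℝ := fun s => g s - (g a + m * (s - a)) - μ * ((s - a) * (b - s)) with hf
  have hfc : ContinuousOn f (Set.Icc a b) := by
    refine (hg.sub ?_).sub ?_ <;> fun_prop
  obtain ⟨t, ht, hmax⟩ := isCompact_Icc.exists_isMaxOn ⟨z, hz⟩ hfc
  have hfz : 0 < f z := by simp only [hf]; linarith
  have hft : f z ≤ f t := hmax hz
  have hfa : f a = 0 := by simp [hf]
  have hfb : f b = 0 := by simp only [hf]; linarith [sub_self b, mul_zero (μ * (b - a))]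
  have htI : t ∈ Set.Ioo a b := by
    refine ⟨lt_of_le_of_ne ht.1 ?_, lt_of_le_of_ne ht.2 ?_⟩
    · rintro rfl; linarith
    · rintro rfl; linarith
  refine hno t htI (m + μ * (b - t) - μ * (t - a)) (μ / 2) (by positivity) ?_
  have hnear : ∀ᶠ s in 𝓝 (0 : ℝ), t + s ∈ Set.Icc a b := by
    have : Tendsto (fun s : ℝ => t + s) (𝓝 0) (𝓝 t) := by
      simpa using (continuous_const_add t).tendsto (0 : ℝ)
    exact this.eventually (Icc_mem_nhds htI.1 htI.2)
  filter_upwards [hnear] with s hs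
  have h1 : f (t + s) ≤ f t := hmax hs
  simp only [hf] at h1
  nlinarith

lemma curve_below {G : (ℝ × ℝ) × ℝ → ℝ × ℝ} (hG : ContDiff ℝ (⊤ : ℕ∞) G) {Ω : Set (ℝ × ℝ)}
    (hΩ : IsOpen Ω) {u : ℝ × ℝ → ℝ} (hsol : AppSol G Ω u) {γ : ℝ → ℝ × ℝ} {t0 t1 : ℝ}
    (hγΩ : ∀ t ∈ Set.Ioo t0 t1, γ t ∈ Ω)
    (hγ : ∀ t ∈ Set.Ioo t0 t1, HasDerivAt γ (G (γ t, u (γ t))) t) {a b : ℝ} (ha : t0 < a)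
    (hab : a < b) (hb : b < t1) :
    ∀ z ∈ Set.Icc a b, u (γ z) ≤ u (γ a) + (u (γ b) - u (γ a)) / (b - a) * (z - a) := by
  have hsub : ∀ t ∈ Set.Icc a b, t ∈ Set.Ioo t0 t1 := fun t ht =>
    ⟨lt_of_lt_of_le ha ht.1, lt_of_le_of_lt ht.2 hb⟩
  have hu_cont : ContinuousOn u Ω := by
    obtain ⟨U, e, l, hl, he, het, hU, hUl, hul, -⟩ := hsol
    have : LipschitzOnWith ⟨l, hl.le⟩ u Ω := LipschitzOnWith.of_dist_le_mul (fun a ha b hb => by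
      rw [Real.dist_eq, dist_eq_norm]; exact hul a ha b hb)
    exact this.continuousOn
  have hγc : ContinuousOn γ (Set.Icc a b) := fun t ht =>
    (hγ t (hsub t ht)).continuousAt.continuousWithinAt
  refine below_chord (g := fun s => u (γ s)) hab
    (hu_cont.comp hγc (fun t ht => hγΩ t (hsub t ht))) ?_
  intro t ht p κ hκ htouch
  have hnear : ∀ᶠ s in 𝓝 (0 : ℝ), t + s ∈ Set.Ioo t0 t1 := by
    have : Tendsto (fun s : ℝ => t + s) (𝓝 0) (𝓝 t) := by
      simpa using (continuous_const_add t).tendsto (0 : ℝ)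
    have hI := hsub t ⟨ht.1.le, ht.2.le⟩
    exact this.eventually (Ioo_mem_nhds hI.1 hI.2)
  refine no_touch hG hΩ hsol (γ := fun s => γ (t + s)) (p := p) hκ ?_ ?_ ?_
  · filter_upwards [hnear] with s hs using hγΩ _ hs
  · filter_upwards [hnear] with s hs
    exact (hγ _ hs).comp_const_add t s
  · simpa using htouch

theorem stmt_1
    (Ω : Set (ℝ × ℝ)) (hΩo : IsOpen Ω) (hΩb : Bornology.IsBounded Ω)
    (s11 s12 : ℝ × ℝ × ℝ → ℝ) (hs11 : ContDiff ℝ (⊤ : ℕ∞) s11) (hs12 : ContDiff ℝ (⊤ : ℕ∞) s12)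
    (hrank : RankCond s11 s12)
    (u : ℝ × ℝ → ℝ) (lu : NNReal) (hulip : LipschitzOnWith lu u Ω)
    (huvv : IsVVSol s11 s12 Ω u)
    (x : ℝ × ℝ) (hx : x ∈ Ω) (t0 t1 : ℝ) (ht0 : t0 < 0) (ht1 : 0 < t1)
    (γ : ℝ → ℝ × ℝ) (hγ0 : γ 0 = x)
    (hγΩ : ∀ t ∈ Set.Ioo t0 t1, γ t ∈ Ω)
    (hγ : ∀ t ∈ Set.Ioo t0 t1,
      HasDerivAt γ
        (s11 ((γ t).1, (γ t).2, u (γ t)), s12 ((γ t).1, (γ t).2, u (γ t))) t) :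
    ∀ t ∈ Set.Ioo t0 t1,
      DifferentiableAt ℝ (fun s => u (γ s)) t ∧
      DifferentiableAt ℝ (deriv (fun s => u (γ s))) t ∧
      deriv (deriv (fun s => u (γ s))) t = 0 := by
  intro t ht
  have hG := contDiff_GF hs11 hs12
  have hsol := appSol_of_isVVSol hs11 hs12 hΩo hΩb hulip huvv
  have hsol' := hsol.neg hG
  have hG' : ContDiff ℝ (⊤ : ℕ∞) (fun r : (ℝ × ℝ) × ℝ => GF s11 s12 (r.1, -r.2)) := by
    fun_prop
  obtain ⟨a, ha0, hat⟩ := exists_between ht.1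
  obtain ⟨b, hbt, hb1⟩ := exists_between ht.2
  have up := curve_below hG hΩo hsol hγΩ hγ ha0 (hat.trans hbt) hb1
  have dn := curve_below hG' hΩo hsol' hγΩ (fun s hs => by
    have := hγ s hs
    simpa [GF] using this) ha0 (hat.trans hbt) hb1
  have heq : ∀ z ∈ Set.Icc a b,
      u (γ z) = u (γ a) + (u (γ b) - u (γ a)) / (b - a) * (z - a) := by
    intro z hz
    refine le_antisymm (up z hz) ?_
    have h1 := dn z hz
    have h2 : (-u (γ b) - -u (γ a)) / (b - a) * (z - a) =
        -((u (γ b) - u (γ a)) / (b - a) * (z - a)) := by ring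
    rw [h2] at h1
    linarith
  set m := (u (γ b) - u (γ a)) / (b - a) with hm
  have hder : ∀ s ∈ Set.Ioo a b, HasDerivAt (fun s => u (γ s)) m s := by
    intro s hs
    have h1 : HasDerivAt (fun z => u (γ a) + m * (z - a)) m s := by
      simpa using (((hasDerivAt_id s).sub_const a).const_mul m).const_add (u (γ a))
    refine h1.congr_of_eventuallyEq ?_
    filter_upwards [Icc_mem_nhds hs.1 hs.2] with z hz using heq z hz
  have hder2 : deriv (fun s => u (γ s)) =ᶠ[𝓝 t] fun _ => m := by
    filter_upwards [Ioo_mem_nhds hat hbt] with s hs using (hder s hs).deriv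
  have h2 : HasDerivAt (deriv (fun s => u (γ s))) 0 t :=
    (hasDerivAt_const t m).congr_of_eventuallyEq hder2
  exact ⟨(hder t ⟨hat, hbt⟩).differentiableAt, h2.differentiableAt, h2.deriv⟩

end
end

section
/- Let u ∈ C∞(Ω) be a solution of L_{ε,u}u = 0 in Ω and fix k ∈ {1,2}. Then z := X_k u is a solution of M_{ε,u}z = f in Ω, where f = − Σ_{i,j,l} Xᵢ(𝒜_{ij}·ω^l_{k,j}·X_l u) − Σ_{i,l} ω^l_{k,i}·X_l(Xᵢu/√(1+|∇εu|²)). -/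
open MeasureTheory Real Filter Topology

noncomputable section

/-- The coefficient vector of the field `XX i`. -/
def VV (s11 s12 : ℝ × ℝ × ℝ → ℝ) (ε : ℝ) (u : ℝ × ℝ → ℝ) (i : Fin 2) (p : ℝ × ℝ) : ℝ × ℝ :=
  if i = 0 then (s11 (p.1, p.2, u p), s12 (p.1, p.2, u p))
  else (ε * pd3 s11 (p.1, p.2, u p), ε * pd3 s12 (p.1, p.2, u p))

theorem fderiv_pair (f : ℝ × ℝ → ℝ) (p : ℝ × ℝ) (a b : ℝ) :
    fderiv ℝ f p (a, b) = a * pd1 f p + b * pd2 f p := by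
  have : ((a, b) : ℝ × ℝ) = a • ((1, 0) : ℝ × ℝ) + b • ((0, 1) : ℝ × ℝ) := by
    ext <;> simp
  rw [this, map_add, map_smul, map_smul]
  rfl

theorem XX_eq (s11 s12 : ℝ × ℝ × ℝ → ℝ) (ε : ℝ) (u : ℝ × ℝ → ℝ) (i : Fin 2)
    (f : ℝ × ℝ → ℝ) (p : ℝ × ℝ) :
    XX s11 s12 ε u i f p = fderiv ℝ f p (VV s11 s12 ε u i p) := by
  fin_cases i
  · simp [XX, VV, fderiv_pair, X1, VF]
  · simp [XX, VV, fderiv_pair, X2, Yf, VF]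
    ring

theorem pd3_smooth {s : ℝ × ℝ × ℝ → ℝ} (hs : ContDiff ℝ (⊤ : ℕ∞) s) :
    ContDiff ℝ (⊤ : ℕ∞) (pd3 s) := by
  have h : ContDiff ℝ (⊤ : ℕ∞) (fderiv ℝ s) := hs.fderiv_right (by simp)
  exact h.clm_apply contDiff_const

theorem VV_smooth {s11 s12 : ℝ × ℝ × ℝ → ℝ} (hs11 : ContDiff ℝ (⊤ : ℕ∞) s11)
    (hs12 : ContDiff ℝ (⊤ : ℕ∞) s12) (ε : ℝ) {u : ℝ × ℝ → ℝ} (hu : ContDiff ℝ (⊤ : ℕ∞) u)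
    (i : Fin 2) : ContDiff ℝ (⊤ : ℕ∞) (VV s11 s12 ε u i) := by
  have hg : ContDiff ℝ (⊤ : ℕ∞) (fun p : ℝ × ℝ => (p.1, p.2, u p)) :=
    contDiff_fst.prodMk (contDiff_snd.prodMk hu)
  have h3 := pd3_smooth hs11
  have h4 := pd3_smooth hs12
  unfold VV
  split_ifs
  · exact (hs11.comp hg).prodMk (hs12.comp hg)
  · exact (contDiff_const.mul (h3.comp hg)).prodMk (contDiff_const.mul (h4.comp hg))

theorem XX_smooth {s11 s12 : ℝ × ℝ × ℝ → ℝ} (hs11 : ContDiff ℝ (⊤ : ℕ∞) s11)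
    (hs12 : ContDiff ℝ (⊤ : ℕ∞) s12) (ε : ℝ) {u : ℝ × ℝ → ℝ} (hu : ContDiff ℝ (⊤ : ℕ∞) u)
    (i : Fin 2) {f : ℝ × ℝ → ℝ} (hf : ContDiff ℝ (⊤ : ℕ∞) f) :
    ContDiff ℝ (⊤ : ℕ∞) (XX s11 s12 ε u i f) := by
  have h : ContDiff ℝ (⊤ : ℕ∞) (fderiv ℝ f) := hf.fderiv_right (by simp)
  have e : XX s11 s12 ε u i f = fun p => fderiv ℝ f p (VV s11 s12 ε u i p) := by
    funext p; exact XX_eq ..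
  rw [e]
  exact h.clm_apply (VV_smooth hs11 hs12 ε hu i)

theorem Wt_eq (s11 s12 : ℝ × ℝ × ℝ → ℝ) (ε : ℝ) (u : ℝ × ℝ → ℝ) (p : ℝ × ℝ) :
    Wt s11 s12 ε u p =
      Real.sqrt (1 + ((XX s11 s12 ε u 0 u p) ^ 2 + (XX s11 s12 ε u 1 u p) ^ 2)) := by
  unfold Wt gradN
  rw [Real.sq_sqrt (by positivity)]
  rfl

theorem Wt_pos (s11 s12 : ℝ × ℝ × ℝ → ℝ) (ε : ℝ) (u : ℝ × ℝ → ℝ) (p : ℝ × ℝ) :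
    0 < Wt s11 s12 ε u p := by
  unfold Wt; positivity

theorem Wt_smooth {s11 s12 : ℝ × ℝ × ℝ → ℝ} (hs11 : ContDiff ℝ (⊤ : ℕ∞) s11)
    (hs12 : ContDiff ℝ (⊤ : ℕ∞) s12) (ε : ℝ) {u : ℝ × ℝ → ℝ} (hu : ContDiff ℝ (⊤ : ℕ∞) u) :
    ContDiff ℝ (⊤ : ℕ∞) (Wt s11 s12 ε u) := by
  have e : Wt s11 s12 ε u = fun p =>
      Real.sqrt (1 + ((XX s11 s12 ε u 0 u p) ^ 2 + (XX s11 s12 ε u 1 u p) ^ 2)) := by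
    funext p; exact Wt_eq ..
  rw [e]
  have h0 := XX_smooth hs11 hs12 ε hu 0 hu
  have h1 := XX_smooth hs11 hs12 ε hu 1 hu
  refine ContDiff.sqrt (contDiff_const.add ((h0.pow 2).add (h1.pow 2))) ?_
  intro p; positivity

theorem AC_eq (s11 s12 : ℝ × ℝ × ℝ → ℝ) (ε : ℝ) (u : ℝ × ℝ → ℝ) (i j : Fin 2) (p : ℝ × ℝ) :
    AC s11 s12 ε u i j p = ((if i = j then 1 else 0) -
      XX s11 s12 ε u i u p * XX s11 s12 ε u j u p / (Wt s11 s12 ε u p) ^ 2) /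
        Wt s11 s12 ε u p := by
  unfold AC aC
  have : Wt s11 s12 ε u p ^ 2 = 1 + gradN s11 s12 ε u u p ^ 2 := by
    unfold Wt; rw [Real.sq_sqrt (by positivity)]
  rw [this]

theorem AC_smooth {s11 s12 : ℝ × ℝ × ℝ → ℝ} (hs11 : ContDiff ℝ (⊤ : ℕ∞) s11)
    (hs12 : ContDiff ℝ (⊤ : ℕ∞) s12) (ε : ℝ) {u : ℝ × ℝ → ℝ} (hu : ContDiff ℝ (⊤ : ℕ∞) u)
    (i j : Fin 2) : ContDiff ℝ (⊤ : ℕ∞) (AC s11 s12 ε u i j) := by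
  have hW := Wt_smooth hs11 hs12 ε hu
  have hne : ∀ p, Wt s11 s12 ε u p ≠ 0 := fun p => (Wt_pos ..).ne'
  have e : AC s11 s12 ε u i j = fun p => ((if i = j then 1 else 0) -
      XX s11 s12 ε u i u p * XX s11 s12 ε u j u p / (Wt s11 s12 ε u p) ^ 2) /
        Wt s11 s12 ε u p := by
    funext p; exact AC_eq ..
  rw [e]
  exact ContDiff.div (contDiff_const.sub (((XX_smooth hs11 hs12 ε hu i hu).mul
    (XX_smooth hs11 hs12 ε hu j hu)).div (hW.pow 2) (fun p => pow_ne_zero 2 (hne p)))) hW hne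

/-- Chain rule: `X_k (X_i u / W) = Σ_j 𝒜_{ij} X_k X_j u`. -/
theorem chain {s11 s12 : ℝ × ℝ × ℝ → ℝ} (hs11 : ContDiff ℝ (⊤ : ℕ∞) s11)
    (hs12 : ContDiff ℝ (⊤ : ℕ∞) s12) (ε : ℝ) {u : ℝ × ℝ → ℝ} (hu : ContDiff ℝ (⊤ : ℕ∞) u)
    (k i : Fin 2) (p : ℝ × ℝ) :
    XX s11 s12 ε u k (fun q => XX s11 s12 ε u i u q / Wt s11 s12 ε u q) p =
      ∑ j : Fin 2, AC s11 s12 ε u i j p * XX s11 s12 ε u k (XX s11 s12 ε u j u) p := by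
  have hd : ∀ i, HasFDerivAt (XX s11 s12 ε u i u) (fderiv ℝ (XX s11 s12 ε u i u) p) p :=
    fun i => ((XX_smooth hs11 hs12 ε hu i hu).differentiable (by simp) p).hasFDerivAt
  have hW : HasFDerivAt (Wt s11 s12 ε u) (fderiv ℝ (Wt s11 s12 ε u) p) p :=
    ((Wt_smooth hs11 hs12 ε hu).differentiable (by simp) p).hasFDerivAt
  have hp := Wt_pos s11 s12 ε u p
  have hsq : ∀ q, Wt s11 s12 ε u q * Wt s11 s12 ε u q =
      1 + (XX s11 s12 ε u 0 u q * XX s11 s12 ε u 0 u q +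
        XX s11 s12 ε u 1 u q * XX s11 s12 ε u 1 u q) := by
    intro q
    rw [Wt_eq, Real.mul_self_sqrt (by positivity)]; ring
  have e1 := (hW.mul hW).unique ((((hd 0).mul (hd 0)).add ((hd 1).mul (hd 1))).const_add 1
    |>.congr_of_eventuallyEq (Eventually.of_forall hsq))
  have e2 := congrArg (fun L => L (VV s11 s12 ε u k p)) e1
  simp only [add_apply, smul_apply, smul_eq_mul,
    ← XX_eq] at e2
  have hF : ContDiff ℝ (⊤ : ℕ∞) (fun q => XX s11 s12 ε u i u q / Wt s11 s12 ε u q) :=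
    (XX_smooth hs11 hs12 ε hu i hu).div (Wt_smooth hs11 hs12 ε hu) (fun q => (Wt_pos ..).ne')
  have hq := ((hF.differentiable (by simp) p).hasFDerivAt.mul hW).unique
    ((hd i).congr_of_eventuallyEq (Eventually.of_forall fun q =>
      div_mul_cancel₀ _ (Wt_pos s11 s12 ε u q).ne'))
  have hq2 := congrArg (fun L => L (VV s11 s12 ε u k p)) hq
  simp only [add_apply, smul_apply, smul_eq_mul, ← XX_eq] at hq2
  rw [Fin.sum_univ_two, AC_eq, AC_eq]
  have hWk : XX s11 s12 ε u k (Wt s11 s12 ε u) p =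
      (XX s11 s12 ε u 0 u p * XX s11 s12 ε u k (XX s11 s12 ε u 0 u) p +
       XX s11 s12 ε u 1 u p * XX s11 s12 ε u k (XX s11 s12 ε u 1 u) p) / Wt s11 s12 ε u p := by
    rw [eq_div_iff hp.ne']
    linarith
  rw [hWk] at hq2
  have hq3 : XX s11 s12 ε u k (fun q => XX s11 s12 ε u i u q / Wt s11 s12 ε u q) p = _ :=
    eq_div_of_mul_eq hp.ne' ((mul_comm _ _).trans (eq_sub_of_add_eq' hq2))
  rw [hq3]
  fin_cases i
  · simp
    field_simp
    ring
  · simp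
    field_simp
    ring

theorem stmt_3
    (Ω : Set (ℝ × ℝ)) (hΩo : IsOpen Ω) (hΩb : Bornology.IsBounded Ω)
    (s11 s12 : ℝ × ℝ × ℝ → ℝ) (hs11 : ContDiff ℝ (⊤ : ℕ∞) s11) (hs12 : ContDiff ℝ (⊤ : ℕ∞) s12)
    (hrank : RankCond s11 s12)
    (ε : ℝ) (hε : 0 < ε) (hε1 : ε ≤ 1)
    (u : ℝ × ℝ → ℝ) (hu : ContDiff ℝ (⊤ : ℕ∞) u)
    (hL : ∀ p ∈ Ω, Lop s11 s12 ε u p = 0)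
    (ω : Fin 2 → ℝ × ℝ → ℝ)
    (hω : ∀ f : ℝ × ℝ → ℝ, ContDiff ℝ (⊤ : ℕ∞) f → ∀ p ∈ Ω,
      X1 s11 s12 u (X2 s11 s12 ε u f) p - X2 s11 s12 ε u (X1 s11 s12 u f) p =
        ω 0 p * X1 s11 s12 u f p + ω 1 p * X2 s11 s12 ε u f p)
    (k : Fin 2) :
    ∀ p ∈ Ω,
      Mop s11 s12 ε u (XX s11 s12 ε u k u) p =
        -(∑ i : Fin 2, ∑ j : Fin 2, ∑ l : Fin 2,
            XX s11 s12 ε u i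
              (fun q => AC s11 s12 ε u i j q * wAnti ω l k j q * XX s11 s12 ε u l u q) p)
        - ∑ i : Fin 2, ∑ l : Fin 2,
            wAnti ω l k i p *
              XX s11 s12 ε u l
                (fun q => XX s11 s12 ε u i u q / Wt s11 s12 ε u q) p := by
  have sm : ∀ (i : Fin 2) {f : ℝ × ℝ → ℝ}, ContDiff ℝ (⊤ : ℕ∞) f →
      ContDiff ℝ (⊤ : ℕ∞) (XX s11 s12 ε u i f) :=
    fun i f hf => XX_smooth hs11 hs12 ε hu i hf
  have hωd : ∀ l, ∀ p ∈ Ω, DifferentiableAt ℝ (ω l) p := by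
    let c : (ℝ × ℝ → ℝ) → ℝ × ℝ → ℝ := fun f q =>
      XX s11 s12 ε u 0 (XX s11 s12 ε u 1 f) q - XX s11 s12 ε u 1 (XX s11 s12 ε u 0 f) q
    have hc : ∀ f, ContDiff ℝ (⊤ : ℕ∞) f → ContDiff ℝ (⊤ : ℕ∞) (c f) :=
      fun f hf => (sm 0 (sm 1 hf)).sub (sm 1 (sm 0 hf))
    have hx : ContDiff ℝ (⊤ : ℕ∞) (fun q : ℝ × ℝ => q.1) := contDiff_fst
    have hy : ContDiff ℝ (⊤ : ℕ∞) (fun q : ℝ × ℝ => q.2) := contDiff_snd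
    let a : Fin 2 → ℝ × ℝ → ℝ := fun i => XX s11 s12 ε u i (fun q => q.1)
    let b : Fin 2 → ℝ × ℝ → ℝ := fun i => XX s11 s12 ε u i (fun q => q.2)
    let d : ℝ × ℝ → ℝ := fun q => a 0 q * b 1 q - a 1 q * b 0 q
    have hd : ContDiff ℝ (⊤ : ℕ∞) d := ((sm 0 hx).mul (sm 1 hy)).sub ((sm 1 hx).mul (sm 0 hy))
    have hd0 : ∀ q, d q ≠ 0 := by
      intro q
      have h := abs_pos.1 (hrank (q.1, q.2, u q))
      have : d q = ε * (s11 (q.1, q.2, u q) * pd3 s12 (q.1, q.2, u q) -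
          s12 (q.1, q.2, u q) * pd3 s11 (q.1, q.2, u q)) := by
        simp only [d, a, b, XX_eq, fderiv_fst, fderiv_snd]
        simp [VV]
        ring
      rw [this]
      exact mul_ne_zero hε.ne' h
    have h1 : ∀ q ∈ Ω, c (fun q => q.1) q = ω 0 q * a 0 q + ω 1 q * a 1 q :=
      fun q hq => hω _ hx q hq
    have h2 : ∀ q ∈ Ω, c (fun q => q.2) q = ω 0 q * b 0 q + ω 1 q * b 1 q :=
      fun q hq => hω _ hy q hq
    intro l p hp
    have key : ∃ g, ContDiff ℝ (⊤ : ℕ∞) g ∧ ∀ q ∈ Ω, ω l q = g q := by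
      fin_cases l
      · refine ⟨fun q => (c (fun q => q.1) q * b 1 q - c (fun q => q.2) q * a 1 q) / d q,
          (((hc _ hx).mul (sm 1 hy)).sub ((hc _ hy).mul (sm 1 hx))).div hd hd0, ?_⟩
        intro q hq
        simp only [Fin.zero_eta]
        rw [eq_div_iff (hd0 q), h1 q hq, h2 q hq]
        simp only [d]; ring
      · refine ⟨fun q => (c (fun q => q.2) q * a 0 q - c (fun q => q.1) q * b 0 q) / d q,
          (((hc _ hy).mul (sm 0 hx)).sub ((hc _ hx).mul (sm 0 hy))).div hd hd0, ?_⟩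
        intro q hq
        simp only [Fin.mk_one]
        rw [eq_div_iff (hd0 q), h1 q hq, h2 q hq]
        simp only [d]; ring
    obtain ⟨g, hg, hgq⟩ := key
    exact ((hg.differentiable (by simp)) p).congr_of_eventuallyEq
      (Filter.eventually_of_mem (hΩo.mem_nhds hp) hgq)
  have hwd : ∀ l k j, ∀ p ∈ Ω, DifferentiableAt ℝ (wAnti ω l k j) p := by
    intro l k j p hp
    unfold wAnti
    split_ifs
    · exact differentiableAt_const _
    · exact hωd l p hp
    · exact (hωd l p hp).neg
  have comm : ∀ f : ℝ × ℝ → ℝ, ContDiff ℝ (⊤ : ℕ∞) f → ∀ p ∈ Ω, ∀ k i : Fin 2,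
      XX s11 s12 ε u k (XX s11 s12 ε u i f) p = XX s11 s12 ε u i (XX s11 s12 ε u k f) p +
        ∑ l : Fin 2, wAnti ω l k i p * XX s11 s12 ε u l f p := by
    intro f hf p hp k i
    have h : XX s11 s12 ε u 0 (XX s11 s12 ε u 1 f) p - XX s11 s12 ε u 1 (XX s11 s12 ε u 0 f) p
      = ω 0 p * XX s11 s12 ε u 0 f p + ω 1 p * XX s11 s12 ε u 1 f p := hω f hf p hp
    fin_cases k <;> fin_cases i <;> simp [wAnti] <;> linarith
  intro p hp
  have hF : ∀ i, ContDiff ℝ (⊤ : ℕ∞) (fun q => XX s11 s12 ε u i u q / Wt s11 s12 ε u q) :=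
    fun i => (sm i hu).div (Wt_smooth hs11 hs12 ε hu) (fun q => (Wt_pos ..).ne')
  have hD : ∑ i : Fin 2, XX s11 s12 ε u k (XX s11 s12 ε u i
      (fun q => XX s11 s12 ε u i u q / Wt s11 s12 ε u q)) p = 0 := by
    have h0 : (fun q => ∑ i : Fin 2, XX s11 s12 ε u i
      (fun q => XX s11 s12 ε u i u q / Wt s11 s12 ε u q) q) =ᶠ[𝓝 p] fun _ => (0 : ℝ) := by
      refine Filter.eventually_of_mem (hΩo.mem_nhds hp) fun q hq => ?_
      simp only [Fin.sum_univ_two]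
      exact hL q hq
    have h1 := h0.fderiv_eq (𝕜 := ℝ)
    rw [fderiv_fun_sum (fun i _ => (sm i (hF i)).differentiable (by simp) p)] at h1
    have h2 := congrArg (fun L => L (VV s11 s12 ε u k p)) h1
    simpa [XX_eq] using h2
  have hE : ∀ i : Fin 2, XX s11 s12 ε u i (XX s11 s12 ε u k
      (fun q => XX s11 s12 ε u i u q / Wt s11 s12 ε u q)) p =
      ∑ j : Fin 2, (XX s11 s12 ε u i (fun q => AC s11 s12 ε u i j q *
          XX s11 s12 ε u j (XX s11 s12 ε u k u) q) p +
        ∑ l : Fin 2, XX s11 s12 ε u i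
          (fun q => AC s11 s12 ε u i j q * wAnti ω l k j q * XX s11 s12 ε u l u q) p) := by
    intro i
    have hA : ∀ j, DifferentiableAt ℝ (AC s11 s12 ε u i j) p := fun j =>
      (AC_smooth hs11 hs12 ε hu i j).differentiable (by simp) p
    have d1 : ∀ j, DifferentiableAt ℝ (fun q => AC s11 s12 ε u i j q *
          XX s11 s12 ε u j (XX s11 s12 ε u k u) q) p := fun j =>
      (hA j).mul ((sm j (sm k hu)).differentiable (by simp) p)
    have d2 : ∀ j l, DifferentiableAt ℝ (fun q => AC s11 s12 ε u i j q * wAnti ω l k j q *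
        XX s11 s12 ε u l u q) p := fun j l =>
      ((hA j).mul (hwd l k j p hp)).mul ((sm l hu).differentiable (by simp) p)
    have d3 : ∀ j, DifferentiableAt ℝ (fun q => ∑ l : Fin 2, AC s11 s12 ε u i j q *
        wAnti ω l k j q * XX s11 s12 ε u l u q) p := fun j =>
      DifferentiableAt.fun_sum (fun l _ => d2 j l)
    have h0 : (XX s11 s12 ε u k (fun q => XX s11 s12 ε u i u q / Wt s11 s12 ε u q)) =ᶠ[𝓝 p]
        fun q => ∑ j : Fin 2, (AC s11 s12 ε u i j q *
          XX s11 s12 ε u j (XX s11 s12 ε u k u) q +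
          ∑ l : Fin 2, AC s11 s12 ε u i j q * wAnti ω l k j q * XX s11 s12 ε u l u q) := by
      refine Filter.eventually_of_mem (hΩo.mem_nhds hp) fun q hq => ?_
      simp only
      rw [chain hs11 hs12 ε hu k i q]
      refine Finset.sum_congr rfl fun j _ => ?_
      rw [comm u hu q hq k j, mul_add, Finset.mul_sum]
      simp only [mul_assoc]
    rw [XX_eq, h0.fderiv_eq, fderiv_fun_sum (fun j _ => (d1 j).fun_add (d3 j)), sum_apply]
    refine Finset.sum_congr rfl fun j _ => ?_
    rw [fderiv_fun_add (d1 j) (d3 j), fderiv_fun_sum (fun l _ => d2 j l), add_apply, sum_apply]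
    simp only [← XX_eq]
  have hC : ∀ i : Fin 2, XX s11 s12 ε u k (XX s11 s12 ε u i
      (fun q => XX s11 s12 ε u i u q / Wt s11 s12 ε u q)) p = _ :=
    fun i => comm _ (hF i) p hp k i
  simp only [hC, hE] at hD
  simp only [Finset.sum_add_distrib] at hD
  unfold Mop
  linarith

end
end

section
/- Fix x₀ ∈ Ω and α ∈ (0,1), and let u : Ω → ℝ be of Euclidean class C^{1,α}. Define Σⱼᵏ := σⱼᵏ(x₀,u(x₀)) / (σ₁¹σ₂² − σ₁²σ₂¹)(x₀,u(x₀)) for j,k ∈ {1,2}, the frozen exponential coordinates e₀₁(x) := Σ₂²·(x−x₀)₁ − Σ₂¹·(x−x₀)₂ and e₀₂(x) := (1/ε)·(Σ₁¹·(x−x₀)₂ − Σ₁²·(x−x₀)₁), and for h : Ω → ℝ of Euclidean class C^{1,α} the first-order intrinsic Taylor polynomial P_{x₀}h(x) := h(x₀) + e₀₁(x)·X₁h(x₀) + e₀₂(x)·X₂h(x₀). Then there exist ε₀ > 0, a neighborhood U of x₀, and a constant C > 0 depending on ε₀ and U but not on ε, such that for all x ∈ U and all ε ∈ (0,ε₀):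 |h(x) − P_{x₀}h(x)| ≤ C·|x−x₀|^{1+α}, where |x−x₀| is the Euclidean distance. -/
open MeasureTheory Real Filter Topology

noncomputable section

theorem stmt_10
    (Ω : Set (ℝ × ℝ)) (hΩo : IsOpen Ω) (hΩb : Bornology.IsBounded Ω)
    (s11 s12 : ℝ × ℝ × ℝ → ℝ) (hs11 : ContDiff ℝ (⊤ : ℕ∞) s11) (hs12 : ContDiff ℝ (⊤ : ℕ∞) s12)
    (hrank : RankCond s11 s12)
    (x0 : ℝ × ℝ) (hx0 : x0 ∈ Ω) (α : ℝ) (hα0 : 0 < α) (hα1 : α < 1)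
    (u : ℝ × ℝ → ℝ) (hu : EuclC1Alpha Ω α u)
    (h : ℝ × ℝ → ℝ) (hh : EuclC1Alpha Ω α h) :
    ∃ ε0 : ℝ, 0 < ε0 ∧ ∃ U : Set (ℝ × ℝ), IsOpen U ∧ x0 ∈ U ∧ U ⊆ Ω ∧
      ∃ C : ℝ, 0 < C ∧
        ∀ x ∈ U, ∀ ε : ℝ, 0 < ε → ε < ε0 →
          |h x - Pfroz s11 s12 ε u h x0 x| ≤ C * dist x x0 ^ (1 + α) := by
  obtain ⟨hd, H, hH⟩ := hh
  obtain ⟨r, hr, hball⟩ := Metric.isOpen_iff.1 hΩo x0 hx0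
  refine ⟨1, one_pos, Metric.ball x0 r, Metric.isOpen_ball, Metric.mem_ball_self hr, hball,
    |H| + 1, by positivity, ?_⟩
  intro x hx ε hε _
  have hD := abs_pos.1 (hrank (x0.1, x0.2, u x0))
  have hP : Pfroz s11 s12 ε u h x0 x = h x0 + fderiv ℝ h x0 (x - x0) := by
    have e : x - x0 = (x - x0).1 • ((1 : ℝ), (0 : ℝ)) + (x - x0).2 • ((0 : ℝ), (1 : ℝ)) := by
      ext <;> simp
    have e2 : fderiv ℝ h x0 (x - x0) = (x - x0).1 * pd1 h x0 + (x - x0).2 * pd2 h x0 := by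
      conv_lhs => rw [e]
      simp only [map_add, map_smul, smul_eq_mul, pd1, pd2]
    rw [e2]
    simp only [Pfroz, X1, X2, Yf, VF]
    generalize pd1 h x0 = A
    generalize pd2 h x0 = B
    generalize (x - x0).1 = y
    generalize (x - x0).2 = z
    generalize s11 (x0.1, x0.2, u x0) = a at *
    generalize s12 (x0.1, x0.2, u x0) = b at *
    generalize pd3 s11 (x0.1, x0.2, u x0) = c at *
    generalize pd3 s12 (x0.1, x0.2, u x0) = d at *
    have hε' := hε.ne'
    generalize hE : a * d - b * c = D at *
    field_simp
    rw [← hE]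
    ring
  rw [hP]
  have hseg : ∀ y ∈ segment ℝ x0 x, dist y x0 ≤ dist x x0 := by
    intro y hy
    have : segment ℝ x0 x ⊆ Metric.closedBall x0 (dist x x0) :=
      (convex_closedBall x0 _).segment_subset (Metric.mem_closedBall_self dist_nonneg)
        (Metric.mem_closedBall.2 le_rfl)
    exact Metric.mem_closedBall.1 (this hy)
  have key := (convex_segment (𝕜 := ℝ) x0 x).norm_image_sub_le_of_norm_fderiv_le' (f := h)
    (φ := fderiv ℝ h x0) (C := (|H| + 1) * dist x x0 ^ α) (fun y _ => hd y)
    (fun y hy => by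
      have hy' := hseg y hy
      have hyΩ : y ∈ Ω := hball (Metric.mem_ball.2 (hy'.trans_lt (Metric.mem_ball.1 hx)))
      refine (hH y hyΩ x0 hx0).trans ?_
      have h1 : dist y x0 ^ α ≤ dist x x0 ^ α := Real.rpow_le_rpow dist_nonneg hy' hα0.le
      have h2 : 0 ≤ dist y x0 ^ α := Real.rpow_nonneg dist_nonneg _
      have h3 : H ≤ |H| + 1 := (le_abs_self H).trans (by linarith)
      have h4 : (0 : ℝ) ≤ |H| + 1 := by positivity
      exact mul_le_mul h3 h1 h2 h4)
    (left_mem_segment ℝ x0 x) (right_mem_segment ℝ x0 x)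
  rw [← sub_sub, ← Real.norm_eq_abs]
  refine key.trans (le_of_eq ?_)
  rw [← dist_eq_norm, add_comm 1 α, Real.rpow_add_one' dist_nonneg (by linarith)]
  ring


end
end
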